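/- arXiv:2406.12941 — 10 statements merged into one kernel-verified Lean document; each statement's English description precedes it below -/
import Mathlib

section
/- Let t be a positive integer and let α = (a_1, …, a_m) ∈ [n]^m be a t-metered (m,n)-parking function. Then for every i ∈ [n] and every integer j with 1 ≤ j ≤ m − t, the number of indices k with j ≤ k ≤ j + t and a_k ≤ i is at least t + 1 − n + i (as an inequality of integers). -/
/-- One step of the `t`-metered parking process on spots `1,…,n`:
given the outcome list `prev` for the cars that have already entered
(`prev[j-1] = some s` if car `j` parked in spot `s`, `none` if it failed to park),
compute the outcome list after the next car (with preference `pref`) tries to park.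
When the next car enters, the occupied spots are exactly the spots of the previous
`t` cars that are still on the street (all earlier cars have already left), and the
entering car parks in the smallest unoccupied spot `≥ pref` among `1,…,n`, if any. -/
def parkStep (n t : ℕ) (prev : List (Option ℕ)) (pref : ℕ) : List (Option ℕ) :=
  let occ : List ℕ := (prev.drop (prev.length - t)).filterMap id
  prev ++ [((List.range' pref (n + 1 - pref)).filter (fun s => decide (s ∉ occ))).head?]

/-- The outcome of the `t`-metered parking process on spots `1,…,n` for the
preference list `l` (car `i` prefers spot `l[i-1]`); the `i`-th entry is
`some s` if car `i` parks in spot `s`, and `none` if car `i` fails to park. -/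
def parkOutcome (n t : ℕ) (l : List ℕ) : List (Option ℕ) :=
  l.foldl (parkStep n t) []

/-- `l` is a `t`-metered `(m,n)`-parking function: a preference list in `[n]^m`
under which every car parks in the `t`-metered parking scheme. -/
def MeteredPF (m n t : ℕ) (l : List ℕ) : Prop :=
  l.length = m ∧ (∀ x ∈ l, x ∈ Finset.Icc 1 n) ∧
    ∀ o ∈ parkOutcome n t l, o.isSome

/-- `l` is a classical `(m,n)`-parking function: a preference list in `[n]^m` under
which every car parks when no car ever leaves (equivalently, the `t`-metered scheme
with `t = m`, under which no car leaves while cars are still arriving). -/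
def ParkingFunction (m n : ℕ) (l : List ℕ) : Prop :=
  l.length = m ∧ (∀ x ∈ l, x ∈ Finset.Icc 1 n) ∧
    ∀ o ∈ parkOutcome n m l, o.isSome

theorem parkOutcome_append_singleton (n t : ℕ) (l : List ℕ) (a : ℕ) :
    parkOutcome n t (l ++ [a]) = parkStep n t (parkOutcome n t l) a := by
  simp [parkOutcome]

theorem length_parkOutcome (n t : ℕ) (l : List ℕ) :
    (parkOutcome n t l).length = l.length := by
  induction l using List.reverseRecOn with
  | nil => rfl
  | append_singleton l a ih =>
    rw [parkOutcome_append_singleton]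
    simp [parkStep, ih]

/-- A car that parks does so at or beyond its preferred spot, within the street, and not in the
spot of any of the previous `t` cars. -/
theorem parkOutcome_spec (n t : ℕ) (l : List ℕ) (k s : ℕ)
    (h : (parkOutcome n t l)[k]? = some (some s)) :
    l.getD k 0 ≤ s ∧ s ≤ n ∧
      ∀ k' < k, k ≤ k' + t → (parkOutcome n t l)[k']? ≠ some (some s) := by
  induction l using List.reverseRecOn with
  | nil => simp [parkOutcome] at h
  | append_singleton l a ih =>
    have hlen := length_parkOutcome n t l
    rw [parkOutcome_append_singleton] at h ⊢
    simp only [parkStep] at h ⊢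
    rcases lt_trichotomy k l.length with hk | hk | hk
    · rw [List.getElem?_append_left (by omega)] at h
      obtain ⟨h1, h2, h3⟩ := ih h
      refine ⟨by rwa [List.getD_append _ _ _ _ hk], h2, fun k' hk' hkt => ?_⟩
      rw [List.getElem?_append_left (by omega)]
      exact h3 k' hk' hkt
    · rw [List.getElem?_append_right (by omega), hlen, hk, Nat.sub_self,
        List.getElem?_cons_zero, Option.some_inj] at h
      have hs := List.mem_of_head? h
      simp only [List.mem_filter, List.mem_range'_1, decide_eq_true_eq] at hs
      obtain ⟨⟨h1, h2⟩, h3⟩ := hs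
      refine ⟨by simpa [hk] using h1, by omega, fun k' hk' hkt hc => h3 ?_⟩
      rw [List.getElem?_append_left (by omega)] at hc
      refine List.mem_filterMap.2 ⟨some s, ?_, rfl⟩
      refine List.mem_of_getElem? (i := k' - (l.length - t)) ?_
      rw [List.getElem?_drop, ← hc]
      congr 1
      omega
    · rw [List.getElem?_eq_none (by simp; omega)] at h
      simp at h

/-- If `α = (a_1,…,a_m) ∈ [n]^m` is a `t`-metered `(m,n)`-parking function
(`t ≥ 1`), then for every `i ∈ [n]` and every `j` with `1 ≤ j ≤ m - t`, the number of
indices `k` with `j ≤ k ≤ j + t` and `a_k ≤ i` is at least `t + 1 - n + i` (in `ℤ`). -/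
theorem metered_necessary_condition (m n t : ℕ) (ht : 1 ≤ t) (l : List ℕ)
    (hα : MeteredPF m n t l) :
    ∀ i ∈ Finset.Icc 1 n, ∀ j : ℕ, 1 ≤ j → j ≤ m - t →
      (t : ℤ) + 1 - n + i ≤
        (((Finset.Icc j (j + t)).filter (fun k => l.getD (k - 1) 0 ≤ i)).card : ℤ) := by
  obtain ⟨hlen, -, hpark⟩ := hα
  intro i hi j hj hjm
  rw [Finset.mem_Icc] at hi
  have hspot : ∀ k : ℕ, ∃ s, k < m → (parkOutcome n t l)[k]? = some (some s) := by
    intro k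
    by_cases hk : k < m
    · have hk' : k < (parkOutcome n t l).length := by rw [length_parkOutcome, hlen]; exact hk
      obtain ⟨s, hs⟩ := Option.isSome_iff_exists.1 (hpark _ (List.getElem_mem hk'))
      exact ⟨s, fun _ => by rw [List.getElem?_eq_getElem hk', hs]⟩
    · exact ⟨0, fun h => absurd h hk⟩
  choose f hf using hspot
  have hne : ∀ x y, x < y → y < m → y ≤ x + t → f x ≠ f y := by
    intro x y hxy hy hyt he
    refine (parkOutcome_spec n t l y _ (hf y hy)).2.2 x hxy hyt ?_
    rw [hf x (by omega), he]
  have hcard : ((Finset.Icc j (j + t)).filter (fun k => ¬ l.getD (k - 1) 0 ≤ i)).card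
      ≤ (Finset.Ioc i n).card := by
    refine Finset.card_le_card_of_injOn (fun k => f (k - 1)) ?_ ?_
    · intro k hk
      simp only [Finset.coe_filter, Finset.mem_Icc, Set.mem_ofPred_eq] at hk
      obtain ⟨h1, h2, -⟩ := parkOutcome_spec n t l (k - 1) _ (hf (k - 1) (by omega))
      simp only [Finset.coe_Ioc, Set.mem_Ioc]
      omega
    · intro x hx y hy hxy
      simp only [Finset.coe_filter, Finset.mem_Icc, Set.mem_ofPred_eq] at hx hy
      rcases lt_trichotomy x y with h | h | h
      · exact absurd hxy (hne _ _ (by omega) (by omega) (by omega))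
      · exact h
      · exact absurd hxy.symm (hne _ _ (by omega) (by omega) (by omega))
  have hsum := Finset.card_filter_add_card_filter_not (s := Finset.Icc j (j + t))
    (fun k => l.getD (k - 1) 0 ≤ i)
  rw [Nat.card_Icc] at hsum
  rw [Nat.card_Ioc] at hcard
  omega
end

section
/- Let m, n, t be positive integers and let α = (a_1, …, a_m) ∈ [n]^m. Under the t-metered parking scheme: (i) every car i that parks does so in a spot p_i satisfying p_i − a_i ≤ t; and (ii) every car i whose preference satisfies a_i ≤ n − t parks (so the only cars that may fail to park are those with a_i ≥ n − t + 1). In particular, every α ∈ [n − t]^m is a t-metered (m,n)-parking function, and hence mpf_{m,n}(t) ≥ (n − t)^m. -/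
theorem exists_notMem_of_length_le {occ : List ℕ} {t : ℕ} (a : ℕ) (h : occ.length ≤ t) :
    ∃ s ∈ Finset.Icc a (a + t), s ∉ occ := by
  by_contra! hc
  have hsub : Finset.Icc a (a + t) ⊆ occ.toFinset := fun s hs => by simpa using hc s hs
  have hcard := (Finset.card_le_card hsub).trans occ.toFinset_card_le
  simp only [Nat.card_Icc] at hcard
  omega

theorem sub_le_of_head?_filter_range' {occ : List ℕ} {n t a p : ℕ} (h : occ.length ≤ t)
    (hp : ((List.range' a (n + 1 - a)).filter (fun s => decide (s ∉ occ))).head? = some p) :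
    p - a ≤ t := by
  obtain ⟨s, hs, hso⟩ := exists_notMem_of_length_le a h
  rw [Finset.mem_Icc] at hs
  rw [List.head?_filter, List.find?_range'_eq_some] at hp
  by_contra hlt
  have := hp.2.2 s hs.1 (by omega)
  simp [hso] at this

theorem isSome_head?_filter_range' {occ : List ℕ} {n t a : ℕ} (h : occ.length ≤ t)
    (ha : a + t ≤ n) :
    ((List.range' a (n + 1 - a)).filter (fun s => decide (s ∉ occ))).head?.isSome := by
  obtain ⟨s, hs, hso⟩ := exists_notMem_of_length_le a h
  rw [Finset.mem_Icc] at hs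
  rw [List.head?_filter, List.find?_isSome]
  exact ⟨s, by rw [List.mem_range'_1]; omega, by simpa using hso⟩

theorem exists_getD_parkOutcome_eq (n t : ℕ) (l : List ℕ) {i : ℕ} (hi : i < l.length) :
    ∃ occ : List ℕ, occ.length ≤ t ∧ (parkOutcome n t l).getD i none =
      ((List.range' (l.getD i 0) (n + 1 - l.getD i 0)).filter
        (fun s => decide (s ∉ occ))).head? := by
  induction l using List.reverseRecOn with
  | nil => simp at hi
  | append_singleton l a ih =>
    have hlen := length_parkOutcome n t l
    rw [parkOutcome_append_singleton, parkStep]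
    rcases Nat.lt_or_ge i l.length with h | h
    · rw [List.getD_append _ _ _ _ (hlen ▸ h), List.getD_append _ _ _ _ h]
      exact ih h
    · obtain rfl : i = l.length := by
        rw [List.length_append, List.length_singleton] at hi
        omega
      refine ⟨((parkOutcome n t l).drop ((parkOutcome n t l).length - t)).filterMap id, ?_, ?_⟩
      · refine (List.length_filterMap_le _ _).trans ?_
        rw [List.length_drop]
        omega
      · rw [List.getD_append_right _ _ _ _ hlen.le, List.getD_append_right _ _ _ _ le_rfl, hlen]
        simp

theorem isSome_getD_parkOutcome {n t : ℕ} {l : List ℕ} {i : ℕ} (hi : i < l.length)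
    (ha : l.getD i 0 + t ≤ n) : ((parkOutcome n t l).getD i none).isSome := by
  obtain ⟨occ, hocc, h⟩ := exists_getD_parkOutcome_eq n t l hi
  rw [h]
  exact isSome_head?_filter_range' hocc ha

theorem getD_mem_of_lt_length {l : List ℕ} {i : ℕ} (hi : i < l.length) : l.getD i 0 ∈ l := by
  rw [List.getD_eq_getElem _ _ hi]
  exact List.getElem_mem hi

theorem meteredPF_of_forall_mem_Icc {n t : ℕ} {l : List ℕ}
    (hl : ∀ x ∈ l, x ∈ Finset.Icc 1 (n - t)) : MeteredPF l.length n t l := by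
  refine ⟨rfl, fun x hx => ?_, fun o ho => ?_⟩
  · have := Finset.mem_Icc.1 (hl x hx)
    exact Finset.mem_Icc.2 (by omega)
  · obtain ⟨i, hi, rfl⟩ := List.mem_iff_getElem.1 ho
    have hi' : i < l.length := length_parkOutcome n t l ▸ hi
    have := Finset.mem_Icc.1 (hl _ (getD_mem_of_lt_length hi'))
    rw [← List.getD_eq_getElem _ none hi]
    exact isSome_getD_parkOutcome hi' (by omega)

theorem finite_setOf_meteredPF (m n t : ℕ) : {l : List ℕ | MeteredPF m n t l}.Finite := by
  refine (Set.finite_range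
    (fun f : Fin m → Fin (n + 1) => List.ofFn (fun i => (f i : ℕ)))).subset ?_
  rintro l ⟨rfl, hl, -⟩
  refine ⟨fun i => ⟨l[i], ?_⟩, ?_⟩
  · have := Finset.mem_Icc.1 (hl _ (l.getElem_mem i.isLt))
    exact Nat.lt_succ_of_le this.2
  · exact List.ofFn_getElem

theorem pow_le_ncard_meteredPF (m n t : ℕ) :
    (n - t) ^ m ≤ Set.ncard {l : List ℕ | MeteredPF m n t l} := by
  let g : (Fin m → Fin (n - t)) → List ℕ := fun f => List.ofFn (fun i => (f i : ℕ) + 1)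
  have hg : Function.Injective g := fun f f' h => by
    funext i
    have := congrFun (List.ofFn_injective h) i
    exact Fin.ext (Nat.succ_injective this)
  have hsub : Set.range g ⊆ {l : List ℕ | MeteredPF m n t l} := by
    rintro _ ⟨f, rfl⟩
    have h : MeteredPF (g f).length n t (g f) := meteredPF_of_forall_mem_Icc fun x hx => by
      obtain ⟨i, rfl⟩ := (List.mem_ofFn' _ _).1 hx
      have hi := (f i).isLt
      exact Finset.mem_Icc.2 ⟨Nat.succ_pos _, hi⟩
    rwa [List.length_ofFn] at h
  calc (n - t) ^ m = (Set.range g).ncard := by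
        rw [← Set.image_univ, Set.ncard_image_of_injective _ hg, Set.ncard_univ]
        simp
    _ ≤ _ := Set.ncard_le_ncard hsub (finite_setOf_meteredPF m n t)

/-- For `α = (a_1,…,a_m) ∈ [n]^m` and `t ≥ 1`, under the `t`-metered
parking scheme:
(i) every car `i` that parks does so in a spot `p_i` with `p_i - a_i ≤ t`;
(ii) every car `i` with `a_i ≤ n - t` parks (so only cars with `a_i ≥ n - t + 1` may
fail to park).
In particular, every `α ∈ [n-t]^m` is a `t`-metered `(m,n)`-parking function, and
hence `mpf_{m,n}(t) ≥ (n - t)^m`. -/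
theorem displacement_and_lower_bound (m n t : ℕ) (hm : 1 ≤ m) (hn : 1 ≤ n) (ht : 1 ≤ t) :
    (∀ l : List ℕ, l.length = m → (∀ x ∈ l, x ∈ Finset.Icc 1 n) →
      (∀ i ∈ Finset.Icc 1 m, ∀ p : ℕ,
          (parkOutcome n t l).getD (i - 1) none = some p → p - l.getD (i - 1) 0 ≤ t) ∧
      (∀ i ∈ Finset.Icc 1 m, l.getD (i - 1) 0 ≤ n - t →
          ((parkOutcome n t l).getD (i - 1) none).isSome)) ∧
    (∀ l : List ℕ, l.length = m → (∀ x ∈ l, x ∈ Finset.Icc 1 (n - t)) →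
      MeteredPF m n t l) ∧
    (n - t) ^ m ≤ Set.ncard {l : List ℕ | MeteredPF m n t l} := by
  refine ⟨fun l hlen hl => ⟨fun i hi p hp => ?_, fun i hi ha => ?_⟩, fun l hlen hl => ?_,
    pow_le_ncard_meteredPF m n t⟩
  · rw [Finset.mem_Icc] at hi
    obtain ⟨occ, hocc, h⟩ := exists_getD_parkOutcome_eq n t l (i := i - 1) (by omega)
    exact sub_le_of_head?_filter_range' hocc (h ▸ hp)
  · rw [Finset.mem_Icc] at hi
    have hi' : i - 1 < l.length := by omega
    have := Finset.mem_Icc.1 (hl _ (getD_mem_of_lt_length hi'))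
    exact isSome_getD_parkOutcome hi' (by omega)
  · subst hlen
    exact meteredPF_of_forall_mem_Icc hl
end

section
/- For every positive integer n and every integer t ≥ 1, the number of t-metered (2,n)-parking functions is mpf_{2,n}(t) = n² − 1. -/
theorem parkOutcome_pair {n t a b : ℕ} (ht : 1 ≤ t) (ha : a ≤ n) :
    parkOutcome n t [a, b] = [some a,
      ((List.range' b (n + 1 - b)).filter (fun s => decide (s ≠ a))).head?] := by
  obtain ⟨k, hk⟩ : ∃ k, n + 1 - a = k + 1 := ⟨n - a, by omega⟩
  have h0 : 1 - t = 0 := by omega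
  simp [parkOutcome, parkStep, hk, List.range'_succ, h0]

theorem isSome_head?_filter_range'_iff {n a b : ℕ} (ha : a ≤ n) (hb : b ≤ n) :
    ((List.range' b (n + 1 - b)).filter (fun s => decide (s ≠ a))).head?.isSome ↔
      ¬ (a = n ∧ b = n) := by
  rw [List.isSome_head?, ne_eq, List.filter_eq_nil_iff, not_iff_not]
  simp only [List.mem_range'_1, decide_eq_true_eq, not_not]
  constructor
  · intro h
    have hb' := h b (by omega)
    have hn' := h n (by omega)
    omega
  · rintro ⟨rfl, rfl⟩ s hs
    omega

theorem meteredPF_two_iff {n t : ℕ} (ht : 1 ≤ t) (l : List ℕ) :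
    MeteredPF 2 n t l ↔
      ∃ p ∈ (Finset.Icc 1 n ×ˢ Finset.Icc 1 n).erase (n, n), [p.1, p.2] = l := by
  constructor
  · rintro ⟨hl, hmem, hout⟩
    obtain ⟨a, b, rfl⟩ := List.length_eq_two.mp hl
    have ha := hmem a (by simp)
    have hb := hmem b (by simp)
    have ha' := (Finset.mem_Icc.mp ha).2
    have hb' := (Finset.mem_Icc.mp hb).2
    rw [parkOutcome_pair ht ha'] at hout
    have h := (isSome_head?_filter_range'_iff ha' hb').mp (hout _ (by simp))
    refine ⟨(a, b), ?_, rfl⟩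
    simp only [Finset.mem_erase, Finset.mem_product, ne_eq, Prod.mk.injEq]
    exact ⟨h, ha, hb⟩
  · rintro ⟨⟨a, b⟩, hp, rfl⟩
    simp only [Finset.mem_erase, Finset.mem_product, ne_eq, Prod.mk.injEq] at hp
    obtain ⟨h, ha, hb⟩ := hp
    have ha' := (Finset.mem_Icc.mp ha).2
    have hb' := (Finset.mem_Icc.mp hb).2
    refine ⟨rfl, ?_, ?_⟩
    · intro x hx
      rcases List.mem_pair.mp hx with rfl | rfl <;> assumption
    · rw [parkOutcome_pair ht ha']
      intro o ho
      rcases List.mem_pair.mp ho with rfl | rfl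
      · rfl
      · exact (isSome_head?_filter_range'_iff ha' hb').mpr h

/-- For every positive integer `n` and every integer `t ≥ 1`, the number
of `t`-metered `(2,n)`-parking functions is `mpf_{2,n}(t) = n² - 1`. -/
theorem mpf_two_cars (n t : ℕ) (hn : 1 ≤ n) (ht : 1 ≤ t) :
    Set.ncard {l : List ℕ | MeteredPF 2 n t l} = n ^ 2 - 1 := by
  have hset : {l : List ℕ | MeteredPF 2 n t l} =
      Set.image (fun p : ℕ × ℕ => [p.1, p.2])
        ((Finset.Icc 1 n ×ˢ Finset.Icc 1 n).erase (n, n) : Finset (ℕ × ℕ)) := by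
    ext l
    exact meteredPF_two_iff ht l
  have hinj : Function.Injective (fun p : ℕ × ℕ => [p.1, p.2]) := by
    rintro ⟨a, b⟩ ⟨c, d⟩ h
    simpa using h
  rw [hset, Set.ncard_image_of_injective _ hinj, Set.ncard_coe_finset,
    Finset.card_erase_of_mem (by simp [hn]), Finset.card_product, Nat.card_Icc,
    Nat.add_sub_cancel, sq]
end

section
/- Let 0 < m ≤ n and let α = (a_1, …, a_m) ∈ [n]^m. Under the 1-metered parking scheme with preference list α, for each i ∈ [m], car i parks in its preferred spot a_i if and only if a_i is the first entry of a lace in the lace decomposition lace(α); equivalently, car i fails to park in spot a_i (it is displaced by one, or fails to park when a_i = n) if and only if a_i is not the first entry of a lace in lace(α). -/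
/-- `w` is a lace: a sequence `(p, p, p+1, p+2, …, p+ℓ-2)` of length `ℓ ≥ 2`, or a
singleton `(p)`, for some positive integer `p`.  Uniformly, `w = p :: (p, p+1, …)`. -/
def IsLace (w : List ℕ) : Prop :=
  ∃ p : ℕ, 1 ≤ p ∧ w = p :: List.range' p (w.length - 1)

/-- `d` is the lace decomposition of `l`: a partition of `l` (from left to right, into
blocks of consecutively indexed entries) into laces, each maximally long, i.e. no lace
can be extended by the first entry of the following block. -/
def IsLaceDecomp (l : List ℕ) (d : List (List ℕ)) : Prop :=
  d.flatten = l ∧ (∀ w ∈ d, IsLace w) ∧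
    ∀ i : ℕ, i + 1 < d.length →
      ¬ IsLace (d.getD i [] ++ [(d.getD (i + 1) []).headI])

/-- Position `i` (1-indexed) in `l` is the first entry of a lace of the lace
decomposition `d` of `l`. -/
def IsLaceStart (d : List (List ℕ)) (i : ℕ) : Prop :=
  ∃ k, k < d.length ∧ ((d.take k).map List.length).sum + 1 = i

/-- The spot taken by a car preferring `x` when the only possibly occupied spot is `o`. -/
def meteredSpot (n : ℕ) (o : Option ℕ) (x : ℕ) : Option ℕ :=
  ((List.range' x (n + 1 - x)).filter (fun s => decide (s ∉ o.toList))).head?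

/-- Outcomes of the `1`-metered scheme for the preference list `l`, where `o` is the outcome
of the car that entered just before. -/
def meteredFrom (n : ℕ) : Option ℕ → List ℕ → List (Option ℕ)
  | _, [] => []
  | o, x :: xs => meteredSpot n o x :: meteredFrom n (meteredSpot n o x) xs

theorem parkStep_one_append (n : ℕ) (prev : List (Option ℕ)) (o : Option ℕ) (x : ℕ) :
    parkStep n 1 (prev ++ [o]) x = (prev ++ [o]) ++ [meteredSpot n o x] := by
  cases o <;> simp [parkStep, meteredSpot]

theorem foldl_parkStep_one_append (n : ℕ) (l : List ℕ) (prev : List (Option ℕ))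
    (o : Option ℕ) :
    l.foldl (parkStep n 1) (prev ++ [o]) = (prev ++ [o]) ++ meteredFrom n o l := by
  induction l generalizing prev o with
  | nil => simp [meteredFrom]
  | cons x xs ih =>
    rw [List.foldl_cons, parkStep_one_append, ih]
    simp [meteredFrom]

theorem parkOutcome_one (n : ℕ) (l : List ℕ) :
    parkOutcome n 1 l = meteredFrom n none l := by
  cases l with
  | nil => rfl
  | cons x xs =>
    have h : parkStep n 1 [] x = [] ++ [meteredSpot n none x] := by
      simp [parkStep, meteredSpot]
    rw [parkOutcome, List.foldl_cons, h, foldl_parkStep_one_append]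
    simp [meteredFrom]

theorem meteredSpot_of_ne {n x : ℕ} {o : Option ℕ} (hx : x ≤ n) (ho : o ≠ some x) :
    meteredSpot n o x = some x := by
  obtain ⟨k, hk⟩ : ∃ k, n + 1 - x = k + 1 := ⟨n - x, by omega⟩
  simp [meteredSpot, hk, List.range'_succ, ho]

theorem meteredSpot_self {n x : ℕ} (hx : x ≤ n) :
    meteredSpot n (some x) x = if x + 1 ≤ n then some (x + 1) else none := by
  split_ifs with h
  · obtain ⟨k, hk⟩ : ∃ k, n + 1 - x = k + 2 := ⟨n - x - 1, by omega⟩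
    simp [meteredSpot, hk, List.range'_succ]
  · have hk : n + 1 - x = 1 := by omega
    simp [meteredSpot, hk, List.range'_succ]

theorem meteredFrom_range'_append {n : ℕ} (k p : ℕ) (rest : List ℕ) (hp : p ≤ n)
    (hk : p + k ≤ n + 1) :
    meteredFrom n (some p) (List.range' p k ++ rest) =
      (List.range' p k).map (fun x => if x + 1 ≤ n then some (x + 1) else none) ++
        meteredFrom n (if p + k ≤ n then some (p + k) else none) rest := by
  induction k generalizing p with
  | zero => simp [hp]
  | succ k ih =>
    simp only [List.range'_succ, List.cons_append, meteredFrom, List.map_cons,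
      meteredSpot_self hp]
    by_cases h : p + 1 ≤ n
    · rw [if_pos h, ih (p + 1) h (by omega), show p + 1 + k = p + (k + 1) by omega]
    · obtain rfl : k = 0 := by omega
      simp [h]

theorem isLaceStart_cons (w : List ℕ) (d : List (List ℕ)) (i : ℕ) :
    IsLaceStart (w :: d) i ↔ i = 1 ∨ ∃ j, IsLaceStart d j ∧ i = w.length + j := by
  constructor
  · rintro ⟨k, hk, rfl⟩
    cases k with
    | zero => simp
    | succ k =>
      refine Or.inr ⟨_, ⟨k, by simpa using hk, rfl⟩, ?_⟩
      simp [add_assoc]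
  · rintro (rfl | ⟨_, ⟨k, hk, rfl⟩, rfl⟩)
    · exact ⟨0, by simp, by simp⟩
    · exact ⟨k + 1, by simpa using hk, by simp [add_assoc]⟩

theorem IsLaceStart.pos {d : List (List ℕ)} {i : ℕ} (h : IsLaceStart d i) : 0 < i := by
  obtain ⟨k, -, rfl⟩ := h
  omega

theorem meteredFrom_getD_eq_iff {n : ℕ} (d : List (List ℕ)) (o : Option ℕ)
    (hmem : ∀ x ∈ d.flatten, x ≤ n) (hlace : ∀ w ∈ d, IsLace w)
    (hmax : ∀ i : ℕ, i + 1 < d.length →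
      ¬ IsLace (d.getD i [] ++ [(d.getD (i + 1) []).headI]))
    (ho : d ≠ [] → o ≠ some (d.getD 0 []).headI) (j : ℕ) (hj : j < d.flatten.length) :
    (meteredFrom n o d.flatten).getD j none = some (d.flatten.getD j 0) ↔
      IsLaceStart d (j + 1) := by
  induction d generalizing o j with
  | nil => simp at hj
  | cons w d ih =>
    obtain ⟨p, hp1, hw⟩ := hlace w (by simp)
    generalize w.length - 1 = k at hw
    subst hw
    have hpn : p ≤ n := hmem p (by simp)
    have hkn : p + k ≤ n + 1 := by
      rcases Nat.eq_zero_or_pos k with rfl | hk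
      · omega
      · have := hmem (p + k - 1) (by
          rw [List.flatten_cons, List.mem_append, List.mem_cons, List.mem_range'_1]
          omega)
        omega
    have hop : meteredSpot n o p = some p :=
      meteredSpot_of_ne hpn (by simpa using ho (by simp))
    have hrun : meteredFrom n o ((p :: List.range' p k) :: d).flatten =
        some p :: ((List.range' p k).map (fun x => if x + 1 ≤ n then some (x + 1) else none) ++
          meteredFrom n (if p + k ≤ n then some (p + k) else none) d.flatten) := by
      rw [List.flatten_cons, List.cons_append, meteredFrom, hop,
        meteredFrom_range'_append k p _ hpn hkn]
    rw [hrun, isLaceStart_cons, List.flatten_cons, List.cons_append]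
    cases j with
    | zero => simp
    | succ j =>
      rw [List.getD_cons_succ, List.getD_cons_succ]
      by_cases hjk : j < k
      · rw [List.getD_append _ _ _ _ (by simpa using hjk),
          List.getD_append _ _ _ _ (by simpa using hjk)]
        refine iff_of_false ?_ ?_
        · simp only [List.getD_eq_getElem?_getD, List.getElem?_map, List.getElem?_range' hjk]
          simp only [Option.map_some, Option.getD_some]
          split_ifs <;> simp
        · rintro (h | ⟨i, hi, h⟩)
          · omega
          · have := hi.pos
            simp at h
            omega
      · rw [List.getD_append_right _ _ _ _ (by simpa using hjk),
          List.getD_append_right _ _ _ _ (by simpa using hjk)]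
        simp only [List.length_map, List.length_range']
        rw [ih _ (fun x hx => hmem x (by
            rw [List.flatten_cons]; exact List.mem_append_right _ hx))
          (fun w hw => hlace w (List.mem_cons_of_mem _ hw))
          (fun i hi => by simpa using hmax (i + 1) (by simpa using hi)) ?_ (j - k)
          (by simp at hj ⊢; omega)]
        · constructor
          · exact fun h => Or.inr ⟨_, h, by simp; omega⟩
          · rintro (h | ⟨i, hi, h⟩)
            · omega
            · simp at h
              rwa [show j - k + 1 = i by omega]
        · intro hd heq
          have hlast := hmax 0 (by simpa using List.length_pos_of_ne_nil hd)
          split_ifs at heq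
          apply hlast
          refine ⟨p, hp1, ?_⟩
          simp only [List.getD_cons_zero, zero_add, List.getD_cons_succ] at heq ⊢
          rw [← Option.some.inj heq]
          simp [List.range'_concat]

/-- Let `0 < m ≤ n` and `α = (a_1,…,a_m) ∈ [n]^m` with lace decomposition
`d`.  Under the `1`-metered parking scheme, car `i` parks in its preferred spot `a_i`
if and only if `a_i` is the first entry of a lace of `d` (equivalently, car `i` fails
to park in spot `a_i` iff `a_i` is not the first entry of a lace of `d`). -/
theorem lucky_iff_lace_start (m n : ℕ) (hm : 0 < m) (hmn : m ≤ n) (l : List ℕ)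
    (hlen : l.length = m) (hmem : ∀ x ∈ l, x ∈ Finset.Icc 1 n)
    (d : List (List ℕ)) (hd : IsLaceDecomp l d) :
    ∀ i ∈ Finset.Icc 1 m,
      ((parkOutcome n 1 l).getD (i - 1) none = some (l.getD (i - 1) 0) ↔
        IsLaceStart d i) := by
  intro i hi
  obtain ⟨hflat, hlace, hmax⟩ := hd
  subst hflat
  rw [Finset.mem_Icc] at hi
  rw [parkOutcome_one, meteredFrom_getD_eq_iff d none
    (fun x hx => (Finset.mem_Icc.mp (hmem x hx)).2) hlace hmax (by simp) (i - 1) (by omega),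
    Nat.sub_add_cancel hi.1]
end

section
/- Let 0 < m ≤ n and let α = (a_1, …, a_m) ∈ [n]^m. Then α is a 1-metered (m,n)-parking function if and only if every entry of α equal to n is located at the beginning of a lace in the lace decomposition lace(α). -/
/-- `ParksAll n c l`: under the `1`-metered scheme on spots `1,…,n`, all cars with preferences
`l` park when `c` is the spot (if any) that is occupied when the first of them enters. -/
def ParksAll (n : ℕ) : Option ℕ → List ℕ → Prop
  | _, [] => True
  | c, a :: l => if c = some a then a + 1 ≤ n ∧ ParksAll n (some (a + 1)) l
      else ParksAll n (some a) l

theorem head?_filter_range' (n a : ℕ) (c : Option ℕ) (ha : a ≤ n) :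
    ((List.range' a (n + 1 - a)).filter (fun s => decide (s ∉ c.toList))).head? =
      if c = some a then (if a + 1 ≤ n then some (a + 1) else none) else some a := by
  obtain ⟨k, rfl⟩ := Nat.exists_eq_add_of_le ha
  rw [show a + k + 1 - a = k + 1 by omega, List.range'_succ]
  by_cases hc : c = some a
  · subst hc
    cases k with
    | zero => simp
    | succ k => simp [List.range'_succ]
  · have : a ∉ c.toList := by simpa using hc
    rw [List.filter_cons_of_pos (by simpa using hc)]
    simp [hc]

theorem mem_foldl_parkStep_of_mem (n t : ℕ) (l : List ℕ) (prev : List (Option ℕ))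
    {o : Option ℕ} (ho : o ∈ prev) : o ∈ l.foldl (parkStep n t) prev := by
  induction l generalizing prev with
  | nil => exact ho
  | cons a l ih => exact ih _ (List.mem_append_left _ ho)

theorem forall_isSome_foldl_parkStep_iff (n : ℕ) (l : List ℕ) (hl : ∀ x ∈ l, x ≤ n)
    (prev : List (Option ℕ)) (c : Option ℕ) (hprev : ∀ o ∈ prev, o.isSome)
    (hc : (prev.drop (prev.length - 1)).filterMap id = c.toList) :
    (∀ o ∈ l.foldl (parkStep n 1) prev, o.isSome) ↔ ParksAll n c l := by
  induction l generalizing prev c with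
  | nil => simpa [ParksAll] using hprev
  | cons a l ih =>
    rw [List.forall_mem_cons] at hl
    have hstep : parkStep n 1 prev a = prev ++
        [if c = some a then (if a + 1 ≤ n then some (a + 1) else none) else some a] := by
      rw [← head?_filter_range' n a c hl.1, ← hc]
      rfl
    have hnext (s : ℕ) :
        (∀ o ∈ l.foldl (parkStep n 1) (prev ++ [some s]), o.isSome) ↔ ParksAll n (some s) l := by
      refine ih hl.2 _ _ ?_ (by simp)
      intro o ho
      rcases List.mem_append.1 ho with ho | ho
      · exact hprev o ho
      · simp_all
    rw [List.foldl_cons, hstep, ParksAll]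
    split_ifs with h1 h2
    · simpa [h2] using hnext (a + 1)
    · refine iff_of_false (fun h => ?_) (fun h => h2 h.1)
      simpa using h none (mem_foldl_parkStep_of_mem n 1 l _ (by simp))
    · exact hnext a

theorem parksAll_range'_append_iff (n p k : ℕ) (l : List ℕ) :
    ParksAll n (some p) (List.range' p k ++ l) ↔
      (k ≠ 0 → p + k ≤ n) ∧ ParksAll n (some (p + k)) l := by
  induction k generalizing p with
  | zero => simp
  | succ k ih =>
    rw [List.range'_succ, List.cons_append, ParksAll, if_pos rfl, ih,
      show p + 1 + k = p + (k + 1) by omega, ← and_assoc]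
    refine and_congr_left fun _ => ?_
    omega

theorem isLace_append_singleton {p k : ℕ} (hp : 1 ≤ p) :
    IsLace (p :: List.range' p k ++ [p + k]) :=
  ⟨p, hp, by simp [List.range'_concat]⟩

theorem parksAll_flatten_iff (n : ℕ) (d : List (List ℕ)) (c : Option ℕ)
    (hle : ∀ x ∈ d.flatten, x ≤ n) (hlace : ∀ w ∈ d, IsLace w)
    (hmax : ∀ i : ℕ, i + 1 < d.length → ¬ IsLace (d.getD i [] ++ [(d.getD (i + 1) []).headI]))
    (hc : d ≠ [] → c ≠ some (d.getD 0 []).headI) :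
    ParksAll n c d.flatten ↔ ∀ w ∈ d, n ∉ w.tail := by
  induction d generalizing c with
  | nil => simp [ParksAll]
  | cons w d ih =>
    obtain ⟨p, hp, hw⟩ := hlace w List.mem_cons_self
    generalize w.length - 1 = k at hw
    subst hw
    have hcp : c ≠ some p := by simpa using hc
    have hrest : ParksAll n (some (p + k)) d.flatten ↔ ∀ w ∈ d, n ∉ w.tail := by
      refine ih _ (fun x hx => hle x ?_) (fun w hw => hlace w (List.mem_cons_of_mem _ hw))
        (fun i hi => ?_) (fun hd h => ?_)
      · rw [List.flatten_cons]
        exact List.mem_append_right _ hx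
      · simpa using hmax (i + 1) (by simpa using hi)
      · refine hmax 0 (by simpa [List.length_pos_iff] using hd) ?_
        have h' : (d.getD 0 []).headI = p + k := (Option.some.inj h).symm
        rw [List.getD_cons_succ, h', List.getD_cons_zero]
        exact isLace_append_singleton hp
    have hlast : k ≠ 0 → p + k - 1 ≤ n := fun hk => hle _ (by
      simp only [List.flatten_cons, List.cons_append, List.mem_cons, List.mem_append,
        List.mem_range'_1]
      omega)
    rw [List.flatten_cons, List.cons_append, ParksAll, if_neg hcp, parksAll_range'_append_iff,
      hrest, List.forall_mem_cons, List.tail_cons, List.mem_range'_1]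
    refine and_congr_left fun _ => ?_
    have hpn : p ≤ n := hle p (by simp)
    omega

/-- Let `0 < m ≤ n` and `α = (a_1,…,a_m) ∈ [n]^m` with lace decomposition
`d`.  Then `α` is a `1`-metered `(m,n)`-parking function if and only if every entry of
`α` equal to `n` is located at the beginning of a lace of `d` (i.e., no lace of `d`
contains `n` anywhere other than as its first entry). -/
theorem one_metered_iff_n_at_lace_start (m n : ℕ) (hm : 0 < m) (hmn : m ≤ n)
    (l : List ℕ) (hlen : l.length = m) (hmem : ∀ x ∈ l, x ∈ Finset.Icc 1 n)
    (d : List (List ℕ)) (hd : IsLaceDecomp l d) :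
    MeteredPF m n 1 l ↔ ∀ w ∈ d, n ∉ w.tail := by
  obtain ⟨rfl, hlace, hmax⟩ := hd
  have hle : ∀ x ∈ d.flatten, x ≤ n := fun x hx => (Finset.mem_Icc.1 (hmem x hx)).2
  rw [← parksAll_flatten_iff n d none hle hlace hmax (by simp),
    ← forall_isSome_foldl_parkStep_iff n d.flatten hle [] none (by simp) (by simp)]
  exact ⟨fun h => h.2.2, fun h => ⟨hlen, hmem, h⟩⟩
end

section
/- If 1 ≤ m ≤ j < k ≤ n, then the number of 1-metered (m,n)-parking functions in which the last car (car m) parks in spot j equals the number of 1-metered (m,n)-parking functions in which the last car parks in spot k; that is, z_j(m,n) = z_k(m,n). -/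
theorem parkStep_one_append_singleton (n : ℕ) (q : List (Option ℕ)) (p a : ℕ) (ha : a ≤ n) :
    parkStep n 1 (q ++ [some p]) a =
      q ++ [some p] ++ [if a ≠ p then some a else if a < n then some (a + 1) else none] := by
  obtain ⟨d, rfl⟩ := Nat.exists_eq_add_of_le ha
  have hd : a + d + 1 - a = d + 1 := by omega
  by_cases hp : a = p
  · subst hp
    cases d <;> simp [parkStep, List.range'_succ, hd]
  · simp [parkStep, List.range'_succ, hd, hp]

/-- The `1`-metered `(m,n)`-parking functions in which the last car parks in spot `i`. -/
def lastSpotSet (m n i : ℕ) : Set (List ℕ) :=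
  {l | MeteredPF m n 1 l ∧ (parkOutcome n 1 l).getD (m - 1) none = some i}

theorem MeteredPF.exists_parkOutcome_eq {m n : ℕ} {l : List ℕ} (hm : 1 ≤ m)
    (h : MeteredPF m n 1 l) : ∃ q p, parkOutcome n 1 l = q ++ [some p] ∧ q.length = m - 1 := by
  have hlen := (length_parkOutcome n 1 l).trans h.1
  rcases List.eq_nil_or_concat (parkOutcome n 1 l) with h0 | ⟨q, o, h0⟩
  · simp [h0] at hlen
    omega
  · have ho := h.2.2 o (by simp [h0])
    obtain ⟨p, rfl⟩ := Option.isSome_iff_exists.1 ho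
    refine ⟨q, p, by simpa using h0, ?_⟩
    simp [h0] at hlen
    omega

theorem append_singleton_mem_lastSpotSet {m n i a : ℕ} {l : List ℕ} (hm : 1 ≤ m)
    (hi : 2 ≤ i) (hin : i ≤ n) :
    l ++ [a] ∈ lastSpotSet (m + 1) n i ↔
      (MeteredPF m n 1 l ∧ l ∉ lastSpotSet m n i ∧ a = i) ∨
        (l ∈ lastSpotSet m n (i - 1) ∧ a = i - 1) := by
  have key : l ++ [a] ∈ lastSpotSet (m + 1) n i ↔
      MeteredPF m n 1 l ∧ 1 ≤ a ∧ a ≤ n ∧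
        parkStep n 1 (parkOutcome n 1 l) a = parkOutcome n 1 l ++ [some i] := by
    simp only [lastSpotSet, MeteredPF, Set.mem_ofPred_eq, parkOutcome_append_singleton]
    have hlen := length_parkOutcome n 1 l
    constructor
    · rintro ⟨⟨h1, h2, h3⟩, h4⟩
      have h1' : l.length = m := by simpa using h1
      have ha := Finset.mem_Icc.1 (h2 a (by simp))
      refine ⟨⟨h1', fun x hx => h2 x (by simp [hx]), fun o ho => h3 o ?_⟩, ha.1, ha.2, ?_⟩
      · simp [parkStep, ho]
      · rw [h1'] at hlen
        simp only [parkStep] at h4 ⊢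
        rw [List.getD_append_right _ _ _ _ (by omega)] at h4
        simp only [hlen, Nat.add_sub_cancel, Nat.sub_self, List.getD_cons_zero] at h4
        rw [← h4, hlen]
    · rintro ⟨⟨h1, h2, h3⟩, ha1, ha2, h4⟩
      rw [h4]
      refine ⟨⟨by simp [h1], ?_, ?_⟩, ?_⟩
      · intro x hx
        rcases List.mem_append.1 hx with hx | hx
        · exact h2 x hx
        · rw [List.mem_singleton.1 hx]
          exact Finset.mem_Icc.2 ⟨ha1, ha2⟩
      · intro o ho
        rcases List.mem_append.1 ho with ho | ho
        · exact h3 o ho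
        · simp [List.mem_singleton.1 ho]
      · rw [List.getD_append_right _ _ _ _ (by omega)]
        simp [hlen, h1]
  rw [key]
  by_cases hl : MeteredPF m n 1 l
  · obtain ⟨q, p, hq, hlen⟩ := hl.exists_parkOutcome_eq hm
    have hlast : ∀ s, l ∈ lastSpotSet m n s ↔ p = s := fun s => by
      simp [lastSpotSet, hl, hq, ← hlen]
    simp only [hlast, hl, hq, true_and]
    constructor
    · rintro ⟨h1, h2, h3⟩
      rw [parkStep_one_append_singleton n q p a h2] at h3
      simp only [List.append_cancel_left_eq, List.cons.injEq, and_true] at h3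
      grind
    · intro h
      have h2 : a ≤ n := by omega
      refine ⟨by omega, h2, ?_⟩
      rw [parkStep_one_append_singleton n q p a h2]
      simp only [List.append_cancel_left_eq, List.cons.injEq, and_true]
      grind
  · simp [lastSpotSet, hl]

theorem lastSpotSet_succ {m n i : ℕ} (hm : 1 ≤ m) (hi : 2 ≤ i) (hin : i ≤ n) :
    lastSpotSet (m + 1) n i =
      (· ++ [i]) '' ({l | MeteredPF m n 1 l} \ lastSpotSet m n i) ∪
        (· ++ [i - 1]) '' lastSpotSet m n (i - 1) := by
  ext l
  rcases List.eq_nil_or_concat l with rfl | ⟨l, a, rfl⟩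
  · simp [lastSpotSet, MeteredPF]
  · rw [List.concat_eq_append, append_singleton_mem_lastSpotSet hm hi hin]
    simp only [Set.mem_union, Set.mem_image, Set.mem_sdiff, Set.mem_ofPred_eq]
    constructor
    · rintro (⟨h1, h2, rfl⟩ | ⟨h1, rfl⟩)
      · exact Or.inl ⟨l, ⟨h1, h2⟩, rfl⟩
      · exact Or.inr ⟨l, h1, rfl⟩
    · rintro (⟨l', ⟨h1, h2⟩, h⟩ | ⟨l', h1, h⟩) <;>
        obtain ⟨rfl, h'⟩ := List.append_inj' h rfl <;> simp_all

theorem lastSpotSet_subset (m n i : ℕ) : lastSpotSet m n i ⊆ {l | MeteredPF m n 1 l} :=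
  fun _ h => h.1

theorem ncard_lastSpotSet_succ {m n i : ℕ} (hm : 1 ≤ m) (hi : 2 ≤ i) (hin : i ≤ n) :
    (lastSpotSet (m + 1) n i).ncard + (lastSpotSet m n i).ncard =
      {l | MeteredPF m n 1 l}.ncard + (lastSpotSet m n (i - 1)).ncard := by
  have hfin := finite_setOf_meteredPF m n 1
  rw [lastSpotSet_succ hm hi hin, Set.ncard_union_eq ?_
    ((hfin.subset Set.sdiff_subset).image _) ((hfin.subset (lastSpotSet_subset m n _)).image _),
    Set.ncard_image_of_injective _ (List.append_left_injective _),
    Set.ncard_image_of_injective _ (List.append_left_injective _), add_right_comm,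
    Set.ncard_sdiff_add_ncard_of_subset (lastSpotSet_subset m n i) hfin]
  · rw [Set.disjoint_left]
    rintro _ ⟨l, -, rfl⟩ ⟨l', -, h⟩
    have := (List.append_inj' h rfl).2
    simp at this
    omega

theorem lastSpotSet_one {n i : ℕ} (hi : 1 ≤ i) (hin : i ≤ n) : lastSpotSet 1 n i = {[i]} := by
  have hstep : ∀ a, a ≤ n → parkOutcome n 1 [a] = [some a] := fun a ha => by
    have : n + 1 - a = (n - a) + 1 := by omega
    simp [parkOutcome, parkStep, this, List.range'_succ]
  ext l
  simp only [lastSpotSet, MeteredPF, Set.mem_ofPred_eq, Set.mem_singleton_iff]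
  constructor
  · rintro ⟨⟨h1, h2, -⟩, h4⟩
    obtain ⟨a, rfl⟩ := List.length_eq_one_iff.1 h1
    have ha := Finset.mem_Icc.1 (h2 a (by simp))
    rw [hstep a ha.2] at h4
    simpa using h4
  · rintro rfl
    simp [hstep i hin, hi, hin]

theorem ncard_lastSpotSet_eq {m n : ℕ} (hm : 1 ≤ m) :
    ∀ {j k : ℕ}, m ≤ j → m ≤ k → j ≤ n → k ≤ n →
      (lastSpotSet m n j).ncard = (lastSpotSet m n k).ncard := by
  induction m, hm using Nat.le_induction with
  | base =>
    intro j k hj hk hjn hkn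
    simp [lastSpotSet_one, hj, hk, hjn, hkn]
  | succ m hm ih =>
    have key : ∀ i, m + 1 ≤ i → i ≤ n →
        (lastSpotSet (m + 1) n i).ncard = {l | MeteredPF m n 1 l}.ncard := fun i hi hin => by
      have h := ncard_lastSpotSet_succ hm (by omega : 2 ≤ i) hin
      have := ih (by omega : m ≤ i) (by omega : m ≤ i - 1) hin (by omega)
      omega
    intro j k hj hk hjn hkn
    rw [key j hj hjn, key k hk hkn]


/-- If `1 ≤ m ≤ j < k ≤ n`, then the number of `1`-metered
`(m,n)`-parking functions in which the last car (car `m`) parks in spot `j` equals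
the number of `1`-metered `(m,n)`-parking functions in which the last car parks in
spot `k`; that is, `z_j(m,n) = z_k(m,n)`. -/
theorem last_spot_count_eq (m n j k : ℕ) (h1 : 1 ≤ m) (h2 : m ≤ j) (h3 : j < k)
    (h4 : k ≤ n) :
    Set.ncard {l : List ℕ | MeteredPF m n 1 l ∧
        (parkOutcome n 1 l).getD (m - 1) none = some j} =
      Set.ncard {l : List ℕ | MeteredPF m n 1 l ∧
        (parkOutcome n 1 l).getD (m - 1) none = some k} := by
  exact ncard_lastSpotSet_eq h1 h2 (h2.trans h3.le) (h3.le.trans h4) h4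
end

section
/- For integers 1 ≤ m ≤ n, the number of 1-metered parking functions satisfies the recursion mpf_{m+1,n}(1) = n · mpf_{m,n}(1) − mpf_{m−1,n}(1), where mpf_{1,n}(1) = n and, by convention, mpf_{0,n}(1) = 1. -/
/-- The spot taken by a car preferring `a` when only spot `p` is occupied (`n + 1` encodes failure
once it exceeds the length of the street). -/
def nextSpot (p a : ℕ) : ℕ := if a = p then p + 1 else a

/-- The preference lists of length `k` under which all cars park in the `1`-metered scheme, when
the last car before them stands in spot `p`; there are none if `p` lies beyond the street. -/
def continuations (n : ℕ) : ℕ → ℕ → Finset (List ℕ)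
  | 0, p => if p ≤ n then {[]} else ∅
  | k + 1, p =>
    if p ≤ n then
      (Finset.Icc 1 n).biUnion fun a => (continuations n k (nextSpot p a)).image (List.cons a)
    else ∅

theorem continuations_eq_empty {n k p : ℕ} (hp : n < p) : continuations n k p = ∅ := by
  cases k <;> simp [continuations, hp]

theorem mem_continuations_cons {n k p a : ℕ} {l : List ℕ} (hp : p ≤ n) :
    a :: l ∈ continuations n (k + 1) p ↔
      a ∈ Finset.Icc 1 n ∧ l ∈ continuations n k (nextSpot p a) := by
  simp only [continuations, if_pos hp, Finset.mem_biUnion, Finset.mem_image, List.cons.injEq]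
  constructor
  · rintro ⟨b, hb, l', hl', rfl, rfl⟩
    exact ⟨hb, hl'⟩
  · rintro ⟨ha, hl⟩
    exact ⟨a, ha, l, hl, rfl, rfl⟩

theorem nil_notMem_continuations_succ {n k p : ℕ} : [] ∉ continuations n (k + 1) p := by
  simp only [continuations]
  split_ifs <;> simp

theorem card_continuations_succ {n k p : ℕ} (hp : p ≤ n) :
    (continuations n (k + 1) p).card =
      ∑ a ∈ Finset.Icc 1 n, (continuations n k (nextSpot p a)).card := by
  rw [continuations, if_pos hp, Finset.card_biUnion]
  · exact Finset.sum_congr rfl fun a _ =>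
      Finset.card_image_of_injective _ (List.cons_injective)
  · intro a _ b _ hab
    rw [Function.onFun, Finset.disjoint_left]
    intro l hl hl'
    obtain ⟨u, -, rfl⟩ := Finset.mem_image.1 hl
    obtain ⟨v, -, h⟩ := Finset.mem_image.1 hl'
    exact hab (List.cons.inj h).1.symm

theorem card_continuations_succ_zero (n k : ℕ) :
    (continuations n (k + 1) 0).card = ∑ a ∈ Finset.Icc 1 n, (continuations n k a).card := by
  rw [card_continuations_succ (Nat.zero_le n)]
  refine Finset.sum_congr rfl fun a ha => ?_
  rw [nextSpot, if_neg (by have := (Finset.mem_Icc.1 ha).1; omega)]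

theorem card_continuations_succ_add {n k p : ℕ} (h1 : 1 ≤ p) (hp : p ≤ n) :
    (continuations n (k + 1) p).card + (continuations n k p).card =
      (continuations n (k + 1) 0).card + (continuations n k (p + 1)).card := by
  have hmem : p ∈ Finset.Icc 1 n := Finset.mem_Icc.2 ⟨h1, hp⟩
  rw [card_continuations_succ hp, card_continuations_succ_zero,
    ← Finset.sum_erase_add _ _ hmem,
    ← Finset.sum_erase_add _ (fun a => (continuations n k a).card) hmem]
  have : ∑ a ∈ (Finset.Icc 1 n).erase p, (continuations n k (nextSpot p a)).card =
      ∑ a ∈ (Finset.Icc 1 n).erase p, (continuations n k a).card :=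
    Finset.sum_congr rfl fun a ha => by rw [nextSpot, if_neg (Finset.ne_of_mem_erase ha)]
  rw [this, nextSpot, if_pos rfl]
  omega

/-- Cars too few to reach the end of the street are not affected by the first occupied spot. -/
theorem card_continuations_eq_zero_start {n k p : ℕ} (h1 : 1 ≤ p) (hp : p + k ≤ n) :
    (continuations n k p).card = (continuations n k 0).card := by
  induction k generalizing p with
  | zero => simp [continuations, show p ≤ n by omega]
  | succ k ih =>
    have h := card_continuations_succ_add (k := k) h1 (show p ≤ n by omega)
    rw [ih h1 (by omega), ih (p := p + 1) (by omega) (by omega)] at h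
    omega

theorem card_continuations_recursion {n k : ℕ} (hk : k + 1 ≤ n) :
    (continuations n (k + 2) 0).card + (continuations n k 0).card =
      n * (continuations n (k + 1) 0).card := by
  have htel : ∀ j ≤ n, ∑ a ∈ Finset.Icc 1 j, (continuations n (k + 1) a).card +
      (continuations n k 1).card =
        j * (continuations n (k + 1) 0).card + (continuations n k (j + 1)).card := by
    intro j hj
    induction j with
    | zero => simp
    | succ j ih =>
      have h := card_continuations_succ_add (k := k) (show 1 ≤ j + 1 by omega) hj
      have := ih (by omega)
      rw [Finset.sum_Icc_succ_top (by omega), add_mul]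
      omega
  have h := htel n le_rfl
  rwa [continuations_eq_empty (Nat.lt_succ_self n), Finset.card_empty, add_zero,
    ← card_continuations_succ_zero,
    card_continuations_eq_zero_start le_rfl (show 1 + k ≤ n by omega)] at h

theorem parkStep_one_nil {n a : ℕ} (ha : a ≤ n) : parkStep n 1 [] a = [some a] := by
  obtain ⟨d, rfl⟩ := Nat.exists_eq_add_of_le ha
  simp [parkStep, show a + d + 1 - a = d + 1 by omega, List.range'_succ]

theorem parkStep_one_append_s9 {n p a : ℕ} (prev : List (Option ℕ)) (ha : a ≤ n) :
    parkStep n 1 (prev ++ [some p]) a =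
      prev ++ [some p] ++ [if nextSpot p a ≤ n then some (nextSpot p a) else none] := by
  obtain ⟨d, rfl⟩ := Nat.exists_eq_add_of_le ha
  by_cases h : a = p
  · subst h
    cases d <;>
      simp [parkStep, nextSpot, List.range'_succ, show ∀ d, a + d + 1 - a = d + 1 by omega]
  · simp [parkStep, nextSpot, h, List.range'_succ, show a + d + 1 - a = d + 1 by omega]

theorem subset_foldl_parkStep (n t : ℕ) (prev : List (Option ℕ)) (l : List ℕ) :
    prev ⊆ l.foldl (parkStep n t) prev := by
  induction l generalizing prev with
  | nil => exact List.Subset.refl _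
  | cons a l ih => exact List.Subset.trans (List.subset_append_left _ _) (ih (parkStep n t prev a))

theorem foldl_parkStep_one_isSome_iff {n p k : ℕ} {prev : List (Option ℕ)} {l : List ℕ}
    (hprev : ∀ o ∈ prev, o.isSome) (hp : p ≤ n) :
    (l.length = k ∧ (∀ x ∈ l, x ∈ Finset.Icc 1 n) ∧
      ∀ o ∈ l.foldl (parkStep n 1) (prev ++ [some p]), o.isSome) ↔
      l ∈ continuations n k p := by
  induction l generalizing p k prev with
  | nil =>
    cases k with
    | zero => simpa [continuations, hp, or_imp, forall_and] using hprev
    | succ k => simp [nil_notMem_continuations_succ]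
  | cons a l ih =>
    cases k with
    | zero => simp [continuations, hp]
    | succ k =>
      rw [mem_continuations_cons hp, List.forall_mem_cons, List.length_cons, Nat.succ_inj,
        List.foldl_cons]
      by_cases ha : a ∈ Finset.Icc 1 n
      · rw [parkStep_one_append_s9 prev (Finset.mem_Icc.1 ha).2]
        by_cases hq : nextSpot p a ≤ n
        · rw [if_pos hq, ← ih (prev := prev ++ [some p]) _ hq]
          · tauto
          · simpa [or_imp, forall_and] using hprev
        · rw [if_neg hq, continuations_eq_empty (not_le.1 hq)]
          simp only [Finset.notMem_empty, and_false, iff_false]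
          rintro ⟨-, -, h⟩
          simpa using h none (subset_foldl_parkStep n 1 _ l (by simp))
      · tauto

theorem meteredPF_one_iff {m n : ℕ} {l : List ℕ} :
    MeteredPF m n 1 l ↔ l ∈ continuations n m 0 := by
  cases l with
  | nil =>
    cases m with
    | zero => simp [MeteredPF, parkOutcome, continuations]
    | succ m => simp [MeteredPF, nil_notMem_continuations_succ]
  | cons a l =>
    cases m with
    | zero => simp [MeteredPF, continuations]
    | succ m =>
      rw [mem_continuations_cons (Nat.zero_le n), MeteredPF, parkOutcome, List.forall_mem_cons,
        List.length_cons, Nat.succ_inj, List.foldl_cons]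
      by_cases ha : a ∈ Finset.Icc 1 n
      · have h := Finset.mem_Icc.1 ha
        rw [parkStep_one_nil h.2, nextSpot, if_neg (by omega),
          ← foldl_parkStep_one_isSome_iff (prev := []) (by simp) h.2, List.nil_append]
        tauto
      · tauto

theorem ncard_meteredPF_one (m n : ℕ) :
    Set.ncard {l : List ℕ | MeteredPF m n 1 l} = (continuations n m 0).card := by
  rw [← Set.ncard_coe_finset]
  congr 1
  ext l
  exact meteredPF_one_iff

/-- For `1 ≤ m ≤ n`, the number of `1`-metered parking functions
satisfies the recursion `mpf_{m+1,n}(1) = n·mpf_{m,n}(1) - mpf_{m-1,n}(1)`, where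
`mpf_{1,n}(1) = n` and, by convention, `mpf_{0,n}(1) = 1` (with our definition the
only `0`-car preference list is the empty list, so the convention is automatic). -/
theorem mpf_one_metered_recursion (m n : ℕ) (h1 : 1 ≤ m) (h2 : m ≤ n) :
    Set.ncard {l : List ℕ | MeteredPF 1 n 1 l} = n ∧
    Set.ncard {l : List ℕ | MeteredPF 0 n 1 l} = 1 ∧
    (Set.ncard {l : List ℕ | MeteredPF (m + 1) n 1 l} : ℤ) =
      n * Set.ncard {l : List ℕ | MeteredPF m n 1 l} -
        Set.ncard {l : List ℕ | MeteredPF (m - 1) n 1 l} := by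
  simp only [ncard_meteredPF_one]
  obtain ⟨k, rfl⟩ := Nat.exists_eq_add_of_le' h1
  refine ⟨?_, by simp [continuations], ?_⟩
  · rw [card_continuations_succ_zero, Finset.sum_congr rfl (g := fun _ => 1)]
    · simp
    · intro a ha
      simp [continuations, (Finset.mem_Icc.1 ha).2]
  · have h := card_continuations_recursion h2
    rw [Nat.add_sub_cancel, eq_sub_iff_add_eq]
    exact_mod_cast h
end

section
/- For every integer n ≥ 2, the number of 1-metered (3,n)-parking functions is mpf_{3,n}(1) = n³ − 2n. -/
/-- The spot taken by a car with preference `a ≤ n` when only spot `s` may be occupied. -/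
theorem head?_filter_range'_ne {n a : ℕ} (s : ℕ) (ha : a ≤ n) :
    ((List.range' a (n + 1 - a)).filter (fun x => decide (x ∉ [s]))).head? =
      if a ≠ s then some a else if a < n then some (a + 1) else none := by
  obtain ⟨k, rfl⟩ := Nat.exists_eq_add_of_le ha
  rw [show a + k + 1 - a = k + 1 by omega, List.range'_succ]
  by_cases h : a = s
  · subst h
    cases k with
    | zero => simp
    | succ k => simp [List.range'_succ]
  · simp [h]

/-- The spot taken by a car with preference `a ≤ n` on an empty street. -/
theorem head?_filter_range'_nil {n a : ℕ} (ha : a ≤ n) :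
    ((List.range' a (n + 1 - a)).filter (fun x => decide (x ∉ ([] : List ℕ)))).head? = some a := by
  obtain ⟨k, rfl⟩ := Nat.exists_eq_add_of_le ha
  rw [show a + k + 1 - a = k + 1 by omega, List.range'_succ]
  simp

/-- In the `1`-metered scheme, three cars all park unless the second or the third one wants the
last spot `n` while it is occupied by the car before it. -/
theorem parkOutcome_one_three_isSome_iff {n a b c : ℕ} (ha : a ≤ n) (hb : b ≤ n) (hc : c ≤ n) :
    (∀ o ∈ parkOutcome n 1 [a, b, c], o.isSome) ↔
      ¬ (a = n ∧ b = n) ∧ ¬ (b = n ∧ c = n) ∧ ¬ (a + 1 = n ∧ b + 1 = n ∧ c = n) := by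
  have h1 : parkStep n 1 [] a = [some a] := by
    simpa [parkStep] using head?_filter_range'_nil ha
  have h2 : parkStep n 1 [some a] b =
      [some a, if b ≠ a then some b else if b < n then some (b + 1) else none] := by
    simpa [parkStep] using head?_filter_range'_ne a hb
  have h3 (x y : Option ℕ) (s : ℕ) (hy : y = some s) : parkStep n 1 [x, y] c =
      [x, y, if c ≠ s then some c else if c < n then some (c + 1) else none] := by
    subst hy
    simpa [parkStep] using head?_filter_range'_ne s hc
  have h4 (x : Option ℕ) : ∃ z, parkStep n 1 [x, none] c = [x, none, z] := ⟨_, rfl⟩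
  simp only [parkOutcome, List.foldl_cons, List.foldl_nil, h1, h2]
  by_cases hab : b = a
  · by_cases hbn : b < n
    · rw [if_neg (by simpa using hab), if_pos hbn, h3 _ _ _ rfl]
      split_ifs <;> simp <;> omega
    · rw [if_neg (by simpa using hab), if_neg hbn]
      obtain ⟨z, hz⟩ := h4 (some a)
      rw [hz]
      simp
      omega
  · rw [if_pos hab, h3 _ _ _ rfl]
    split_ifs <;> simp <;> omega

theorem card_filter_one_metered_three_cars (n : ℕ) (hn : 2 ≤ n) :
    ((Finset.Icc 1 n ×ˢ Finset.Icc 1 n ×ˢ Finset.Icc 1 n).filter fun p : ℕ × ℕ × ℕ =>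
      ¬ (p.1 = n ∧ p.2.1 = n) ∧ ¬ (p.2.1 = n ∧ p.2.2 = n) ∧
        ¬ (p.1 + 1 = n ∧ p.2.1 + 1 = n ∧ p.2.2 = n)).card = n ^ 3 - 2 * n := by
  set S : Finset (ℕ × ℕ × ℕ) := Finset.Icc 1 n ×ˢ Finset.Icc 1 n ×ˢ Finset.Icc 1 n with hS
  set B : Finset (ℕ × ℕ × ℕ) := (({n} ×ˢ {n} ×ˢ Finset.Icc 1 n).disjUnion
    (Finset.Icc 1 (n - 1) ×ˢ {n} ×ˢ {n}) (by
      rw [Finset.disjoint_left]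
      rintro ⟨a, b, c⟩
      simp only [Finset.mem_product, Finset.mem_singleton, Finset.mem_Icc]
      omega)).disjUnion {(n - 1, n - 1, n)} (by
      simp only [Finset.disjoint_singleton_right, Finset.mem_disjUnion, Finset.mem_product,
        Finset.mem_singleton, Finset.mem_Icc]
      omega) with hB
  have hBS : B ⊆ S := by
    rintro ⟨a, b, c⟩
    simp only [hB, hS, Finset.mem_disjUnion, Finset.mem_product, Finset.mem_singleton,
      Finset.mem_Icc, Prod.mk.injEq]
    omega
  have hcard : B.card = 2 * n := by
    rw [hB, Finset.card_disjUnion, Finset.card_disjUnion]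
    simp
    omega
  have hfilter : S.filter (fun p : ℕ × ℕ × ℕ =>
      ¬ (p.1 = n ∧ p.2.1 = n) ∧ ¬ (p.2.1 = n ∧ p.2.2 = n) ∧
        ¬ (p.1 + 1 = n ∧ p.2.1 + 1 = n ∧ p.2.2 = n)) = S \ B := by
    ext ⟨a, b, c⟩
    simp only [hB, hS, Finset.mem_filter, Finset.mem_sdiff, Finset.mem_disjUnion,
      Finset.mem_product, Finset.mem_singleton, Finset.mem_Icc, Prod.mk.injEq]
    omega
  rw [hfilter, Finset.card_sdiff_of_subset hBS, hcard]
  simp only [hS, Finset.card_product, Nat.card_Icc, Nat.add_sub_cancel]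
  congr 1
  ring

/-- For every integer `n ≥ 2`, the number of `1`-metered
`(3,n)`-parking functions is `mpf_{3,n}(1) = n³ - 2n`. -/
theorem mpf_one_metered_three_cars (n : ℕ) (hn : 2 ≤ n) :
    Set.ncard {l : List ℕ | MeteredPF 3 n 1 l} = n ^ 3 - 2 * n := by
  rw [← card_filter_one_metered_three_cars n hn, ← Set.ncard_coe_finset]
  symm
  refine Set.ncard_congr (fun p _ => [p.1, p.2.1, p.2.2]) ?_ ?_ ?_
  · rintro ⟨a, b, c⟩ h
    simp only [Finset.coe_filter, Finset.mem_product, Finset.mem_Icc, Set.mem_ofPred_eq] at h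
    obtain ⟨⟨ha, hb, hc⟩, h⟩ := h
    exact ⟨rfl, by simp [ha, hb, hc],
      (parkOutcome_one_three_isSome_iff ha.2 hb.2 hc.2).2 h⟩
  · rintro ⟨a, b, c⟩ ⟨a', b', c'⟩ _ _ h
    simpa using h
  · rintro l ⟨hl, hmem, hpark⟩
    obtain ⟨a, b, c, rfl⟩ := List.length_eq_three.1 hl
    have ha := Finset.mem_Icc.1 (hmem a (by simp))
    have hb := Finset.mem_Icc.1 (hmem b (by simp))
    have hc := Finset.mem_Icc.1 (hmem c (by simp))
    refine ⟨(a, b, c), ?_, rfl⟩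
    simp only [Finset.coe_filter, Finset.mem_product, Finset.mem_Icc, Set.mem_ofPred_eq]
    exact ⟨⟨ha, hb, hc⟩, (parkOutcome_one_three_isSome_iff ha.2 hb.2 hc.2).1 hpark⟩
end

section
/- Let 1 ≤ m ≤ n and k ∈ [n]. Then |Sh_m(k−1, n−k)| equals: C(m−1, n−k) · (n−m+1) · k^{m−n+k−2} · (n−k+1)^{n−k−1} if k > n−m+1; m^{m−2} if k = n−m+1; and 0 if k < n−m+1. Here C(a,b) denotes the binomial coefficient, and a power of the form 1^{−1} (which occurs only in the factor (n−k+1)^{n−k−1} when k = n, and in m^{m−2} when m = 1) is interpreted as 1. -/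
/-- `IsShuffle β δ γ`: the word `γ` is a shuffle of the words `β` and `δ`, i.e. `γ`
can be partitioned into two complementary subsequences equal, in order, to `β`
and `δ`. -/
inductive IsShuffle : List ℕ → List ℕ → List ℕ → Prop
  | nil : IsShuffle [] [] []
  | left {x : ℕ} {xs ys zs : List ℕ} : IsShuffle xs ys zs → IsShuffle (x :: xs) ys (x :: zs)
  | right {y : ℕ} {xs ys zs : List ℕ} : IsShuffle xs ys zs → IsShuffle xs (y :: ys) (y :: zs)

/-- `ShSet m n k` is the set `Sh_m(k-1, n-k)` of `(m,n)`-parking function shuffles: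
sequences `(π_2, …, π_m)` that are shuffles of some `α ∈ PF_{m-n+k-1, k-1}` and a word
`β + (k)^{n-k} = (b_1 + k, …, b_{n-k} + k)` with `β = (b_1,…,b_{n-k}) ∈ PF_{n-k, n-k}`.
If `m - n + k - 1 < 0` (i.e. `m + k < n + 1`) the set is empty. -/
def ShSet (m n k : ℕ) : Set (List ℕ) :=
  {π | n + 1 ≤ m + k ∧ ∃ a b : List ℕ,
      ParkingFunction (m + k - n - 1) (k - 1) a ∧
      ParkingFunction (n - k) (n - k) b ∧
      IsShuffle a (b.map (· + k)) π}

/-- The set of shuffles of two words, as a finset. -/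
def wordShuffles : List ℕ → List ℕ → Finset (List ℕ)
  | [], b => {b}
  | x :: a, [] => {x :: a}
  | x :: a, y :: b =>
      (wordShuffles a (y :: b)).image (List.cons x) ∪
        (wordShuffles (x :: a) b).image (List.cons y)
termination_by a b => a.length + b.length

theorem isShuffle_nil_left_iff {b g : List ℕ} : IsShuffle [] b g ↔ g = b := by
  constructor
  · intro h
    induction b generalizing g with
    | nil => cases h; rfl
    | cons y b ih =>
      cases h with
      | right h => rw [ih h]
  · rintro rfl
    induction g with
    | nil => exact .nil
    | cons y g ih => exact .right ih

theorem isShuffle_nil_right_iff {a g : List ℕ} : IsShuffle a [] g ↔ g = a := by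
  constructor
  · intro h
    induction a generalizing g with
    | nil => cases h; rfl
    | cons y b ih =>
      cases h with
      | left h => rw [ih h]
  · rintro rfl
    induction g with
    | nil => exact .nil
    | cons y g ih => exact .left ih

theorem mem_wordShuffles (a b g : List ℕ) : g ∈ wordShuffles a b ↔ IsShuffle a b g := by
  induction a, b using wordShuffles.induct generalizing g with
  | case1 b => simp [wordShuffles, isShuffle_nil_left_iff]
  | case2 x a => simp [wordShuffles, isShuffle_nil_right_iff]
  | case3 x a y b iha ihb =>
    simp only [wordShuffles, Finset.mem_union, Finset.mem_image, iha, ihb]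
    constructor
    · rintro (⟨g, hg, rfl⟩ | ⟨g, hg, rfl⟩)
      · exact .left hg
      · exact .right hg
    · intro h
      cases h with
      | left h => exact .inl ⟨_, h, rfl⟩
      | right h => exact .inr ⟨_, h, rfl⟩

theorem card_wordShuffles (a b : List ℕ) (h : ∀ x ∈ a, x ∉ b) :
    (wordShuffles a b).card = (a.length + b.length).choose b.length := by
  induction a, b using wordShuffles.induct with
  | case1 b => simp [wordShuffles]
  | case2 x a => simp [wordShuffles]
  | case3 x a y b iha ihb =>
    have hxy : x ≠ y := by
      rintro rfl
      exact h x (by simp) (by simp)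
    rw [wordShuffles, Finset.card_union_of_disjoint,
      Finset.card_image_of_injective _ List.cons_injective,
      Finset.card_image_of_injective _ List.cons_injective,
      iha fun z hz => h z (by simp [hz]),
      ihb fun z hz hb => h z hz (by simp [hb])]
    · simp only [List.length_cons]
      rw [show a.length + 1 + (b.length + 1) = (a.length + 1 + b.length) + 1 by ring,
        Nat.choose_succ_succ, add_comm]
      congr 2
      ring
    · rw [Finset.disjoint_left]
      simp only [Finset.mem_image, not_exists, not_and]
      rintro _ ⟨g, _, rfl⟩ g' _ hg
      exact hxy (List.cons.inj hg).1.symm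

theorem IsShuffle.perm {a b g : List ℕ} (h : IsShuffle a b g) : g.Perm (a ++ b) := by
  induction h with
  | nil => simp
  | left _ ih => exact ih.cons _
  | right _ ih => exact (ih.cons _).trans List.perm_middle.symm

theorem IsShuffle.filter_eq {a b g : List ℕ} (h : IsShuffle a b g) (p : ℕ → Bool)
    (ha : ∀ x ∈ a, p x = true) (hb : ∀ x ∈ b, p x = false) :
    g.filter p = a ∧ g.filter (fun x => !p x) = b := by
  induction h with
  | nil => simp
  | left _ ih => simp_all
  | right _ ih => simp_all

theorem isShuffle_filter (p : ℕ → Bool) (g : List ℕ) :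
    IsShuffle (g.filter p) (g.filter (fun x => !p x)) g := by
  induction g with
  | nil => exact .nil
  | cons x g ih =>
    cases hx : p x
    · simpa [hx] using ih.right
    · simpa [hx] using ih.left

/-- The set of all shuffles of a word of `A` and a word of `B`. -/
def shuffleProduct (A B : Finset (List ℕ)) : Finset (List ℕ) :=
  (A ×ˢ B).biUnion fun ab => wordShuffles ab.1 ab.2

theorem mem_shuffleProduct {A B : Finset (List ℕ)} {g : List ℕ} :
    g ∈ shuffleProduct A B ↔ ∃ a ∈ A, ∃ b ∈ B, IsShuffle a b g := by
  simp only [shuffleProduct, Finset.mem_biUnion, Finset.mem_product, mem_wordShuffles,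
    Prod.exists]
  grind

theorem card_shuffleProduct {A B : Finset (List ℕ)} {p q : ℕ} (P : ℕ → Bool)
    (hA : ∀ a ∈ A, a.length = p ∧ ∀ x ∈ a, P x = true)
    (hB : ∀ b ∈ B, b.length = q ∧ ∀ x ∈ b, P x = false) :
    (shuffleProduct A B).card = (p + q).choose q * A.card * B.card := by
  rw [shuffleProduct, Finset.card_biUnion]
  · rw [Finset.sum_congr rfl (g := fun _ => (p + q).choose q)]
    · simp [Finset.card_product]
      ring
    · rintro ⟨a, b⟩ hab
      rw [Finset.mem_product] at hab
      have ha := hA _ hab.1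
      have hb := hB _ hab.2
      simp only at ha hb ⊢
      rw [card_wordShuffles, ha.1, hb.1]
      intro x hx hx'
      have h1 := ha.2 x hx
      rw [hb.2 x hx'] at h1
      simp at h1
  · rintro ⟨a, b⟩ hab ⟨a', b'⟩ hab' hne
    rw [Finset.mem_coe, Finset.mem_product] at hab hab'
    rw [Function.onFun, Finset.disjoint_left]
    intro g hg hg'
    rw [mem_wordShuffles] at hg hg'
    have h1 := hg.filter_eq P (hA _ hab.1).2 (hB _ hab.2).2
    have h2 := hg'.filter_eq P (hA _ hab'.1).2 (hB _ hab'.2).2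
    exact hne (Prod.ext (h1.1.symm.trans h2.1) (h1.2.symm.trans h2.2))

/-- The words of length `m` over `{1,…,n}` having, for every `j`, at most `n + 1 - j`
letters that are at least `j`, built by inserting the letters `1`. -/
def parkingWords : ℕ → ℕ → Finset (List ℕ)
  | 0, m => if m = 0 then {[]} else ∅
  | n + 1, m =>
      if m ≤ n + 1 then
        (Finset.range (m + 1)).biUnion fun i =>
          shuffleProduct {List.replicate (m - i) 1}
            ((parkingWords n i).image (List.map (· + 1)))
      else ∅

theorem mem_parkingWords (n m : ℕ) (l : List ℕ) :
    l ∈ parkingWords n m ↔ l.length = m ∧ (∀ x ∈ l, x ∈ Finset.Icc 1 n) ∧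
      ∀ j, 1 ≤ j → j ≤ n + 1 → l.countP (fun x => decide (j ≤ x)) + j ≤ n + 1 := by
  induction n generalizing m l with
  | zero =>
    rw [parkingWords]
    split_ifs with hm
    · subst hm
      rw [Finset.mem_singleton]
      constructor
      · rintro rfl
        simp
      · intro h
        exact List.length_eq_zero_iff.mp h.1
    · simp only [Finset.notMem_empty, false_iff]
      rintro ⟨hl, hx, -⟩
      cases l with
      | nil => exact hm hl.symm
      | cons x l => simpa using hx x (by simp)
  | succ n ih =>
    rw [parkingWords]
    split_ifs with hm
    · simp only [Finset.mem_biUnion, mem_shuffleProduct, Finset.mem_singleton,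
        Finset.mem_image, Finset.mem_range]
      constructor
      · rintro ⟨i, hi, _, rfl, _, ⟨b, hb, rfl⟩, hg⟩
        obtain ⟨hlen, hx, hc⟩ := (ih _ _).1 hb
        have hp := hg.perm
        refine ⟨?_, ?_, ?_⟩
        · rw [hp.length_eq]
          simp
          omega
        · intro x hxl
          rw [hp.mem_iff] at hxl
          simp only [List.mem_append, List.mem_replicate, List.mem_map] at hxl
          rw [Finset.mem_Icc]
          rcases hxl with ⟨-, rfl⟩ | ⟨y, hy, rfl⟩
          · omega
          · have := Finset.mem_Icc.1 (hx y hy)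
            omega
        · intro j hj hj'
          rcases Nat.eq_or_lt_of_le hj with rfl | hj1
          · have h1 := List.countP_le_length (p := fun x => decide (1 ≤ x)) (l := l)
            rw [hp.length_eq] at h1
            simp only [List.length_append, List.length_replicate, List.length_map, hlen] at h1
            omega
          · have := hc (j - 1) (by omega) (by omega)
            rw [hp.countP_eq, List.countP_append, List.countP_map, List.countP_replicate]
            have he : ((fun x => decide (j ≤ x)) ∘ fun x => x + 1) =
                fun x : ℕ => decide (j - 1 ≤ x) := by
              funext x
              simp
            rw [he, if_neg (by simpa using hj1)]
            omega
      · rintro ⟨hlen, hx, hc⟩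
        have hs := isShuffle_filter (fun x => decide (x = 1)) l
        have hp := hs.perm
        have hl := hp.length_eq
        rw [List.length_append] at hl
        have hb : ((l.filter fun x => !decide (x = 1)).map (· - 1)).map (· + 1) =
            l.filter fun x => !decide (x = 1) := by
          rw [List.map_map]
          conv_rhs => rw [← List.map_id (l.filter fun x => !decide (x = 1))]
          apply List.map_congr_left
          intro x hxl
          have := Finset.mem_Icc.1 (hx x (List.mem_of_mem_filter hxl))
          simp
          omega
        refine ⟨(l.filter fun x => !decide (x = 1)).length, by omega, _, rfl, _,
          ⟨(l.filter fun x => !decide (x = 1)).map (· - 1), ?_, rfl⟩, ?_⟩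
        · rw [ih]
          refine ⟨by simp, ?_, ?_⟩
          · intro x hxl
            simp only [List.mem_map, List.mem_filter] at hxl
            obtain ⟨y, ⟨hy, hy1⟩, rfl⟩ := hxl
            have := Finset.mem_Icc.1 (hx y hy)
            simp at hy1
            rw [Finset.mem_Icc]
            omega
          · intro j hj hj'
            have h1 := hc (j + 1) (by omega) (by omega)
            have h2 : ((l.filter fun x => !decide (x = 1)).map (· - 1)).countP
                (fun x => decide (j ≤ x)) ≤ l.countP (fun x => decide (j + 1 ≤ x)) := by
              rw [List.countP_map, List.countP_filter]
              apply List.countP_mono_left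
              intro x _ h
              simp at h ⊢
              omega
            omega
        · rw [hb]
          convert hs using 1
          symm
          rw [List.eq_replicate_iff]
          refine ⟨by omega, ?_⟩
          intro x hx
          simpa using (List.mem_filter.1 hx).2
    · simp only [Finset.notMem_empty, false_iff]
      rintro ⟨hlen, hx, hc⟩
      have h1 := hc 1 le_rfl (by omega)
      rw [List.countP_eq_length.2] at h1
      · omega
      · intro x hxl
        simpa using (Finset.mem_Icc.1 (hx x hxl)).1

theorem sum_choose_mul_index (m : ℕ) (x : ℤ) :
    (x + 1) * ∑ i ∈ Finset.range (m + 1), (m.choose i : ℤ) * (i * x ^ i) =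
      m * x * (x + 1) ^ m := by
  cases m with
  | zero => simp
  | succ m =>
    rw [Finset.sum_range_succ']
    have h : ∀ i ∈ Finset.range (m + 1),
        ((m + 1).choose (i + 1) : ℤ) * ((i + 1 : ℕ) * x ^ (i + 1)) =
          (m + 1) * x * (x ^ i * 1 ^ (m - i) * m.choose i) := by
      intro i _
      have := Nat.add_one_mul_choose_eq m i
      zify at this
      push_cast
      linear_combination (-x ^ (i + 1)) * this
    rw [Finset.sum_congr rfl h, ← Finset.mul_sum, ← add_pow]
    push_cast
    ring

theorem card_parkingWords (n m : ℕ) (h : m ≤ n + 1) :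
    ((n : ℤ) + 1) * (parkingWords n m).card = (n + 1 - m) * (n + 1) ^ m := by
  induction n generalizing m with
  | zero =>
    obtain rfl | rfl : m = 0 ∨ m = 1 := by omega
    · simp [parkingWords]
    · simp [parkingWords]
  | succ n ih =>
    by_cases hm : m ≤ n + 1
    · have hcard : (parkingWords (n + 1) m).card =
          ∑ i ∈ Finset.range (m + 1), m.choose i * (parkingWords n i).card := by
        rw [parkingWords, if_pos hm, Finset.card_biUnion]
        · refine Finset.sum_congr rfl fun i hi => ?_
          rw [Finset.mem_range] at hi
          rw [card_shuffleProduct (p := m - i) (q := i) (fun x => decide (x = 1))]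
          · rw [Finset.card_image_of_injective _
              (List.map_injective_iff.2 (add_left_injective 1))]
            simp [show m - i + i = m by omega]
          · simp
          · simp only [Finset.mem_image]
            rintro _ ⟨b, hb, rfl⟩
            obtain ⟨hlen, hx, -⟩ := (mem_parkingWords _ _ _).1 hb
            refine ⟨by simpa using hlen, ?_⟩
            simp only [List.mem_map]
            rintro _ ⟨y, hy, rfl⟩
            have := Finset.mem_Icc.1 (hx y hy)
            simp
            omega
        · intro i hi j hj hij
          rw [Function.onFun, Finset.disjoint_left]
          intro g hg hg'
          simp only [mem_shuffleProduct, Finset.mem_singleton, Finset.mem_image] at hg hg'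
          obtain ⟨_, rfl, _, ⟨b, hb, rfl⟩, hg⟩ := hg
          obtain ⟨_, rfl, _, ⟨b', hb', rfl⟩, hg'⟩ := hg'
          obtain ⟨hlen, hx, -⟩ := (mem_parkingWords _ _ _).1 hb
          obtain ⟨hlen', hx', -⟩ := (mem_parkingWords _ _ _).1 hb'
          have key : ∀ b : List ℕ, (∀ x ∈ b, x ∈ Finset.Icc 1 n) →
              ∀ x ∈ b.map (· + 1), decide (x = 1) = false := by
            intro b hb x hx
            obtain ⟨y, hy, rfl⟩ := List.mem_map.1 hx
            have := Finset.mem_Icc.1 (hb y hy)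
            simp
            omega
          have h1 := (hg.filter_eq (fun x => decide (x = 1)) (by simp) (key b hx)).2
          have h2 := (hg'.filter_eq (fun x => decide (x = 1)) (by simp) (key b' hx')).2
          have h3 := congrArg List.length (h1.symm.trans h2)
          simp [hlen, hlen'] at h3
          exact hij h3
      have hx : ((n : ℤ) + 1) * (parkingWords (n + 1) m).card =
          (n + 1) * (n + 1 + 1) ^ m -
            ∑ i ∈ Finset.range (m + 1), (m.choose i : ℤ) * (i * (n + 1) ^ i) := by
        rw [hcard, add_pow ((n : ℤ) + 1) 1 m, Finset.mul_sum, ← Finset.sum_sub_distrib]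
        push_cast
        rw [Finset.mul_sum]
        refine Finset.sum_congr rfl fun i hi => ?_
        rw [Finset.mem_range] at hi
        have := ih i (by omega)
        rw [one_pow]
        linear_combination (m.choose i : ℤ) * this
      have hs := sum_choose_mul_index m ((n : ℤ) + 1)
      have hn : (n : ℤ) + 1 ≠ 0 := by positivity
      apply mul_left_cancel₀ hn
      push_cast
      linear_combination ((n : ℤ) + 1 + 1) * hx - hs
    · obtain rfl : m = n + 2 := by omega
      rw [parkingWords, if_neg hm]
      push_cast
      simp
      left
      ring

/-- The occupied spots `O` are a possible result of parking cars with preferences `l`. -/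
structure ParkedAt (n : ℕ) (l O : List ℕ) : Prop where
  mem_Icc : ∀ s ∈ O, s ∈ Finset.Icc 1 n
  nodup : O.Nodup
  countP_le : ∀ j, l.countP (fun x => decide (j ≤ x)) ≤ O.countP (fun x => decide (j ≤ x))
  countP_eq : ∀ j, j ∉ O →
    l.countP (fun x => decide (j + 1 ≤ x)) = O.countP (fun x => decide (j + 1 ≤ x))

theorem ParkedAt.countP_add_le {n : ℕ} {l O : List ℕ} (h : ParkedAt n l O) {j : ℕ}
    (hj : j ≤ n + 1) : l.countP (fun x => decide (j ≤ x)) + j ≤ n + 1 := by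
  have h1 := h.countP_le j
  have h2 : O.countP (fun x => decide (j ≤ x)) ≤ (Finset.Icc j n).card := by
    rw [List.countP_eq_length_filter,
      ← List.toFinset_card_of_nodup (h.nodup.filter _)]
    apply Finset.card_le_card
    intro x hx
    simp only [List.mem_toFinset, List.mem_filter, decide_eq_true_eq] at hx
    have := Finset.mem_Icc.1 (h.mem_Icc x hx.1)
    rw [Finset.mem_Icc]
    omega
  rw [Nat.card_Icc] at h2
  omega

theorem ParkedAt.exists_lt_countP {n p : ℕ} {l O : List ℕ} (h : ParkedAt n l O)
    (hp : 1 ≤ p) (hO : ∀ s, p ≤ s → s ≤ n → s ∈ O) :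
    ∃ j, 1 ≤ j ∧ j ≤ p ∧ n + 1 ≤ l.countP (fun x => decide (j ≤ x)) + j := by
  classical
  have hex : ∃ j, ∀ s, j + 1 ≤ s → s ≤ n → s ∈ O :=
    ⟨p - 1, fun s hs => hO s (by omega)⟩
  let j := Nat.find hex
  have hj : ∀ s, j + 1 ≤ s → s ≤ n → s ∈ O := Nat.find_spec hex
  have hjp : j ≤ p - 1 := Nat.find_min' hex fun s hs => hO s (by omega)
  have hjO : j ∉ O := by
    intro hmem
    have hj1 := (Finset.mem_Icc.1 (h.mem_Icc j hmem)).1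
    apply Nat.find_min hex (m := j - 1) (by change j - 1 < j; omega)
    intro s hs hsn
    rcases Nat.eq_or_lt_of_le (show j ≤ s by omega) with rfl | hlt
    · exact hmem
    · exact hj s hlt hsn
  refine ⟨j + 1, by omega, by omega, ?_⟩
  rw [h.countP_eq j hjO]
  have h2 : (Finset.Icc (j + 1) n).card ≤ O.countP (fun x => decide (j + 1 ≤ x)) := by
    rw [List.countP_eq_length_filter,
      ← List.toFinset_card_of_nodup (h.nodup.filter _)]
    apply Finset.card_le_card
    intro x hx
    rw [Finset.mem_Icc] at hx
    simp only [List.mem_toFinset, List.mem_filter, decide_eq_true_eq]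
    exact ⟨hj x hx.1 hx.2, hx.1⟩
  rw [Nat.card_Icc] at h2
  omega

theorem ParkedAt.append {n p s : ℕ} {l O : List ℕ} (h : ParkedAt n l O)
    (hp : 1 ≤ p) (hps : p ≤ s) (hsn : s ≤ n) (hs : s ∉ O)
    (hO : ∀ i, p ≤ i → i < s → i ∈ O) : ParkedAt n (l ++ [p]) (O ++ [s]) where
  mem_Icc := by
    intro x hx
    rcases List.mem_append.1 hx with hx | hx
    · exact h.mem_Icc x hx
    · rw [List.mem_singleton] at hx
      rw [Finset.mem_Icc]
      omega
  nodup := by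
    rw [List.nodup_append]
    refine ⟨h.nodup, by simp, ?_⟩
    grind
  countP_le := by
    intro j
    have := h.countP_le j
    simp only [List.countP_append, List.countP_singleton, decide_eq_true_eq]
    split_ifs <;> omega
  countP_eq := by
    intro j hj
    simp only [List.mem_append, List.mem_singleton, not_or] at hj
    have := h.countP_eq j hj.1
    have h1 : ¬ (p ≤ j ∧ j < s) := fun h2 => hj.1 (hO j h2.1 h2.2)
    simp only [List.countP_append, List.countP_singleton, decide_eq_true_eq]
    split_ifs <;> omega

theorem parkOutcome_append_singleton_s13 {n t p : ℕ} {l : List ℕ} (h : l.length ≤ t) :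
    parkOutcome n t (l ++ [p]) = parkOutcome n t l ++
      [(List.range' p (n + 1 - p)).find?
        (fun s => decide (s ∉ (parkOutcome n t l).filterMap id))] := by
  have hlen := length_parkOutcome n t l
  have h0 : (parkOutcome n t l).length - t = 0 := by omega
  conv_lhs => rw [parkOutcome, List.foldl_append, ← parkOutcome]
  simp only [List.foldl_cons, List.foldl_nil, parkStep, h0, List.drop_zero, List.head?_filter]

theorem parkOutcome_spec_s13 {n t : ℕ} {l : List ℕ} (ht : l.length ≤ t)
    (hl : ∀ x ∈ l, x ∈ Finset.Icc 1 n) :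
    ((∀ o ∈ parkOutcome n t l, o.isSome) →
      ParkedAt n l ((parkOutcome n t l).filterMap id)) ∧
    ((∀ j, 1 ≤ j → j ≤ n + 1 → l.countP (fun x => decide (j ≤ x)) + j ≤ n + 1) →
      ∀ o ∈ parkOutcome n t l, o.isSome) := by
  induction l using List.reverseRecOn with
  | nil =>
    simp only [parkOutcome, List.foldl_nil]
    exact ⟨fun _ => ⟨by simp, by simp, by simp, by simp⟩, by simp⟩
  | append_singleton l p ih =>
    rw [List.length_append, List.length_singleton] at ht
    obtain ⟨ih1, ih2⟩ := ih (by omega) fun x hx => hl x (by simp [hx])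
    have hp := Finset.mem_Icc.1 (hl p (by simp))
    rw [parkOutcome_append_singleton_s13 (by omega)]
    constructor
    · intro h
      have hP := ih1 fun o ho => h o (by simp [ho])
      have hlast := h _ (List.mem_append_right _ (List.mem_singleton_self _))
      obtain ⟨s, hs⟩ := Option.isSome_iff_exists.1 hlast
      rw [hs]
      rw [List.find?_range'_eq_some] at hs
      obtain ⟨hs1, hs2, hs3⟩ := hs
      rw [List.mem_range'_1] at hs2
      rw [List.filterMap_append]
      refine hP.append hp.1 hs2.1 (by omega) (by simpa using hs1) fun i hi his => ?_
      simpa using hs3 i hi his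
    · intro h
      have hsome := ih2 fun j hj hj' => by
        have := h j hj hj'
        rw [List.countP_append] at this
        omega
      have hP := ih1 hsome
      intro o ho
      rcases List.mem_append.1 ho with ho | ho
      · exact hsome o ho
      · rw [List.mem_singleton] at ho
        subst ho
        by_contra hnone
        rw [Option.not_isSome_iff_eq_none, List.find?_eq_none] at hnone
        obtain ⟨j, hj, hjp, hcount⟩ := hP.exists_lt_countP hp.1 fun s hs hsn => by
          have := hnone s (by rw [List.mem_range'_1]; omega)
          simpa using this
        have := h j hj (by omega)
        rw [List.countP_append, List.countP_singleton, if_pos (by simpa using hjp)] at this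
        omega

theorem parkingFunction_iff_mem_parkingWords (m n : ℕ) (l : List ℕ) :
    ParkingFunction m n l ↔ l ∈ parkingWords n m := by
  rw [mem_parkingWords, ParkingFunction]
  constructor
  · rintro ⟨hlen, hl, h⟩
    exact ⟨hlen, hl, fun j _ hj => ((parkOutcome_spec_s13 hlen.le hl).1 h).countP_add_le hj⟩
  · rintro ⟨hlen, hl, h⟩
    exact ⟨hlen, hl, (parkOutcome_spec_s13 hlen.le hl).2 h⟩

theorem card_parkingWords_succ {n m : ℕ} (h : m ≤ n) :
    (parkingWords n (m + 1)).card = (n - m) * (n + 1) ^ m := by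
  have h1 := card_parkingWords n (m + 1) (by omega)
  have hn : (n : ℤ) + 1 ≠ 0 := by positivity
  zify [h]
  apply mul_left_cancel₀ hn
  rw [h1]
  push_cast
  ring

theorem card_parkingWords_zero (n : ℕ) : (parkingWords n 0).card = 1 := by
  have h1 := card_parkingWords n 0 (by omega)
  have hn : (n : ℤ) + 1 ≠ 0 := by positivity
  zify
  apply mul_left_cancel₀ hn
  rw [h1]
  simp

theorem card_parkingWords_self (n : ℕ) : (parkingWords n n).card = (n + 1) ^ (n - 1) := by
  cases n with
  | zero => exact card_parkingWords_zero 0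
  | succ n => simp [card_parkingWords_succ]

theorem ncard_shSet {m n k : ℕ} (hk : k ∈ Finset.Icc 1 n) (h : n + 1 ≤ m + k) :
    (ShSet m n k).ncard = (m - 1).choose (n - k) *
      (parkingWords (k - 1) (m + k - n - 1)).card * (n - k + 1) ^ (n - k - 1) := by
  rw [Finset.mem_Icc] at hk
  have hset : ShSet m n k = shuffleProduct (parkingWords (k - 1) (m + k - n - 1))
      ((parkingWords (n - k) (n - k)).image (List.map (· + k))) := by
    ext g
    simp only [ShSet, Set.mem_ofPred_eq, Finset.mem_coe, mem_shuffleProduct,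
      parkingFunction_iff_mem_parkingWords, Finset.mem_image]
    constructor
    · rintro ⟨-, a, b, ha, hb, hg⟩
      exact ⟨a, ha, _, ⟨b, hb, rfl⟩, hg⟩
    · rintro ⟨a, ha, _, ⟨b, hb, rfl⟩, hg⟩
      exact ⟨h, a, b, ha, hb, hg⟩
  rw [hset, Set.ncard_coe_finset,
    card_shuffleProduct (p := m + k - n - 1) (q := n - k) (fun x => decide (x < k)),
    Finset.card_image_of_injective _ (List.map_injective_iff.2 (add_left_injective k)),
    card_parkingWords_self, show m + k - n - 1 + (n - k) = m - 1 by omega]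
  · intro a ha
    obtain ⟨hlen, hx, -⟩ := (mem_parkingWords _ _ _).1 ha
    refine ⟨hlen, fun x hxa => ?_⟩
    have := Finset.mem_Icc.1 (hx x hxa)
    simp
    omega
  · simp only [Finset.mem_image]
    rintro _ ⟨b, hb, rfl⟩
    obtain ⟨hlen, -, -⟩ := (mem_parkingWords _ _ _).1 hb
    refine ⟨by simpa using hlen, fun x hxb => ?_⟩
    obtain ⟨y, -, rfl⟩ := List.mem_map.1 hxb
    simp

/-- For `1 ≤ m ≤ n` and `k ∈ [n]`, the cardinality of
`Sh_m(k-1, n-k)` is `C(m-1, n-k)·(n-m+1)·k^{m-n+k-2}·(n-k+1)^{n-k-1}` if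
`k > n-m+1`, is `m^{m-2}` if `k = n-m+1`, and is `0` if `k < n-m+1`.  (All exponents
are nonnegative in the relevant cases except that `1^{-1}` is interpreted as `1`,
which is what ℕ-truncation gives here.) -/
theorem shuffle_count (m n k : ℕ) (h1 : 1 ≤ m) (h2 : m ≤ n) (hk : k ∈ Finset.Icc 1 n) :
    Set.ncard (ShSet m n k) =
      if n - m + 1 < k then
        Nat.choose (m - 1) (n - k) * (n - m + 1) * k ^ (m + k - n - 2) *
          (n - k + 1) ^ (n - k - 1)
      else if k = n - m + 1 then m ^ (m - 2)
      else 0 := by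
  have hk' := Finset.mem_Icc.1 hk
  split_ifs with hlt heq
  · rw [ncard_shSet hk (by omega), show m + k - n - 1 = (m + k - n - 2) + 1 by omega,
      card_parkingWords_succ (by omega),
      show k - 1 - (m + k - n - 2) = n - m + 1 by omega, show k - 1 + 1 = k by omega]
    ring
  · rw [ncard_shSet hk (by omega), show m + k - n - 1 = 0 by omega, card_parkingWords_zero,
      show n - k = m - 1 by omega, show m - 1 + 1 = m by omega,
      show m - 1 - 1 = m - 2 by omega]
    simp
  · have hempty : ShSet m n k = ∅ := by
      ext g
      simp only [ShSet, Set.mem_ofPred_eq, Set.mem_empty_iff_false, iff_false]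
      rintro ⟨h, -⟩
      omega
    rw [hempty, Set.ncard_empty]
end

section
/- Let 1 ≤ m ≤ n and j ∈ [n]. If j > n−m+1, then the number of (m,n)-parking functions α = (a_1, …, a_m) with a_1 = j equals Σ_{i=j}^{n} C(m−1, n−i)(n−m+1) i^{i+m−n−2} (n−i+1)^{n−i−1}. If j ≤ n−m+1, then the number of (m,n)-parking functions with a_1 = j equals m^{m−2} + Σ_{i=n−m+2}^{n} C(m−1, n−i)(n−m+1) i^{i+m−n−2} (n−i+1)^{n−i−1}. Here C(a,b) denotes the binomial coefficient, and a power of the form 1^{−1} (which occurs only in the factor (n−i+1)^{n−i−1} when i = n, and in m^{m−2} when m = 1) is interpreted as 1. -/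
namespace ParkingCount

open Finset

/-- The spots occupied after the preferences `l` have been processed. -/
def occupied (n t : ℕ) (l : List ℕ) : List ℕ := (parkOutcome n t l).filterMap id

/-- The spot taken by a car preferring `p` when the spots in `occ` are occupied. -/
def nextSpot (n : ℕ) (occ : List ℕ) (p : ℕ) : Option ℕ :=
  ((List.range' p (n + 1 - p)).filter (fun s => decide (s ∉ occ))).head?

lemma length_parkOutcome (n t : ℕ) (l : List ℕ) : (parkOutcome n t l).length = l.length := by
  induction l using List.reverseRecOn with
  | nil => rfl
  | append_singleton l p ih =>
    simp only [parkOutcome, List.foldl_append, List.foldl_cons, List.foldl_nil, parkStep] at ih ⊢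
    simp [ih]

lemma parkOutcome_append_singleton {n t : ℕ} {l : List ℕ} (h : l.length ≤ t) (p : ℕ) :
    parkOutcome n t (l ++ [p]) = parkOutcome n t l ++ [nextSpot n (occupied n t l) p] := by
  have h0 : (parkOutcome n t l).length - t = 0 := by rw [length_parkOutcome]; omega
  have h1 : parkOutcome n t (l ++ [p]) = parkStep n t (parkOutcome n t l) p := by
    simp [parkOutcome]
  rw [h1, parkStep, h0]
  rfl

lemma occupied_append_singleton {n t : ℕ} {l : List ℕ} (h : l.length ≤ t) (p : ℕ) :
    occupied n t (l ++ [p]) = occupied n t l ++ (nextSpot n (occupied n t l) p).toList := by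
  rw [occupied, parkOutcome_append_singleton h, List.filterMap_append]
  cases nextSpot n (occupied n t l) p <;> rfl

lemma nextSpot_eq_none {n p : ℕ} {occ : List ℕ} (h : nextSpot n occ p = none) {s : ℕ}
    (h1 : p ≤ s) (h2 : s ≤ n) : s ∈ occ := by
  rw [nextSpot, List.head?_eq_none_iff, List.filter_eq_nil_iff] at h
  have := h s (by rw [List.mem_range'_1]; omega)
  simpa using this

lemma nextSpot_eq_some {n p s : ℕ} {occ : List ℕ} (h : nextSpot n occ p = some s) :
    p ≤ s ∧ s ≤ n ∧ s ∉ occ ∧ ∀ k, p ≤ k → k < s → k ∈ occ := by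
  rw [nextSpot, List.head?_filter, List.find?_range'_eq_some] at h
  simp only [decide_eq_true_eq, Bool.not_eq_eq_eq_not, Bool.not_true, decide_eq_false_iff_not,
    List.mem_range'_1, not_not] at h
  obtain ⟨h1, h2, h3⟩ := h
  exact ⟨by omega, by omega, h1, h3⟩

lemma nodup_occupied {n t : ℕ} {l : List ℕ} (h : l.length ≤ t) : (occupied n t l).Nodup := by
  induction l using List.reverseRecOn with
  | nil => simp [occupied, parkOutcome]
  | append_singleton l p ih =>
    have h' : l.length ≤ t := by simp at h; omega
    rw [occupied_append_singleton h']
    cases hs : nextSpot n (occupied n t l) p with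
    | none => simpa using ih h'
    | some s =>
      have := (nextSpot_eq_some hs).2.2.1
      rw [List.nodup_append]
      refine ⟨ih h', by simp, ?_⟩
      rintro a ha b hb rfl
      simp only [Option.toList_some, List.mem_singleton] at hb
      exact this (hb ▸ ha)

lemma le_of_mem_occupied {n t : ℕ} {l : List ℕ} (h : l.length ≤ t) {s : ℕ}
    (hs : s ∈ occupied n t l) : s ≤ n := by
  induction l using List.reverseRecOn with
  | nil => simp [occupied, parkOutcome] at hs
  | append_singleton l p ih =>
    have h' : l.length ≤ t := by simp at h; omega
    rw [occupied_append_singleton h', List.mem_append] at hs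
    rcases hs with hs | hs
    · exact ih h' hs
    · rw [Option.mem_toList] at hs
      exact (nextSpot_eq_some hs).2.1

lemma pos_of_mem_occupied {n t : ℕ} {l : List ℕ} (h : l.length ≤ t) (hl : ∀ x ∈ l, 0 < x)
    {s : ℕ} (hs : s ∈ occupied n t l) : 0 < s := by
  induction l using List.reverseRecOn with
  | nil => simp [occupied, parkOutcome] at hs
  | append_singleton l p ih =>
    have h' : l.length ≤ t := by simp at h; omega
    rw [occupied_append_singleton h', List.mem_append] at hs
    rcases hs with hs | hs
    · exact ih h' (fun x hx => hl x (by simp [hx])) hs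
    · rw [Option.mem_toList] at hs
      exact (hl p (by simp)).trans_le (nextSpot_eq_some hs).1

/-- If every car parks, each car parks at or beyond its preference. -/
lemma countP_le_countP_occupied {n t : ℕ} {l : List ℕ} (h : l.length ≤ t)
    (hl : ∀ o ∈ parkOutcome n t l, o.isSome) (k : ℕ) :
    l.countP (k ≤ ·) ≤ (occupied n t l).countP (k ≤ ·) := by
  induction l using List.reverseRecOn with
  | nil => simp
  | append_singleton l p ih =>
    have h' : l.length ≤ t := by simp at h; omega
    rw [parkOutcome_append_singleton h'] at hl
    have ih := ih h' (fun o ho => hl o (by simp [ho]))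
    have hp := hl _ (List.mem_append_right _ (List.mem_singleton.2 rfl))
    obtain ⟨s, hs⟩ := Option.isSome_iff_exists.1 hp
    have := (nextSpot_eq_some hs).1
    rw [occupied_append_singleton h', hs, List.countP_append, List.countP_append]
    simp only [Option.toList_some, List.countP_singleton, decide_eq_true_eq]
    split_ifs <;> omega

/-- Beyond an unoccupied spot `k` there are at most as many occupied spots as cars preferring
a spot beyond `k`. -/
lemma countP_occupied_le {n t : ℕ} {l : List ℕ} (h : l.length ≤ t) {k : ℕ}
    (hk : k ∉ occupied n t l) :
    (occupied n t l).countP (k + 1 ≤ ·) ≤ l.countP (k + 1 ≤ ·) := by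
  induction l using List.reverseRecOn with
  | nil => simp [occupied, parkOutcome]
  | append_singleton l p ih =>
    have h' : l.length ≤ t := by simp at h; omega
    rw [occupied_append_singleton h', List.mem_append, not_or] at hk
    have ih := ih h' hk.1
    rw [occupied_append_singleton h', List.countP_append, List.countP_append]
    cases hs : nextSpot n (occupied n t l) p with
    | none => simp only [Option.toList_none, List.countP_nil]; omega
    | some s =>
      have h4 := (nextSpot_eq_some hs).2.2.2 k
      have hks : k ≠ s := by simpa [hs] using hk.2
      simp only [Option.toList_some, List.countP_singleton, decide_eq_true_eq]
      split_ifs with h5 h6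
      · omega
      · exact absurd (h4 (by omega) (by omega)) hk.1
      · omega
      · omega

lemma countP_le_of_nodup {n : ℕ} {l : List ℕ} (hd : l.Nodup) (hl : ∀ x ∈ l, x ≤ n) (k : ℕ) :
    l.countP (k ≤ ·) ≤ n + 1 - k := by
  rw [List.countP_eq_length_filter, ← List.toFinset_card_of_nodup (hd.filter _), ← Nat.card_Icc]
  refine card_le_card fun x hx => ?_
  simp only [List.mem_toFinset, List.mem_filter, decide_eq_true_eq] at hx
  exact mem_Icc.2 ⟨hx.2, hl x hx.1⟩

lemma le_countP_of_forall_mem {n k : ℕ} {l : List ℕ} (hl : ∀ x, k ≤ x → x ≤ n → x ∈ l) :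
    n + 1 - k ≤ l.countP (k ≤ ·) := by
  rw [List.countP_eq_length_filter, ← Nat.card_Icc]
  refine (card_le_card fun x hx => ?_).trans (List.toFinset_card_le _)
  rw [mem_Icc] at hx
  simpa using ⟨hl x hx.1 hx.2, hx.1⟩

lemma forall_isSome_parkOutcome_iff {n t : ℕ} {l : List ℕ} (h : l.length ≤ t)
    (hl : ∀ x ∈ l, 0 < x) :
    (∀ o ∈ parkOutcome n t l, o.isSome) ↔ ∀ k, 0 < k → l.countP (k ≤ ·) ≤ n + 1 - k := by
  refine ⟨fun H k _ => (countP_le_countP_occupied h H k).trans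
    (countP_le_of_nodup (nodup_occupied h) (fun x => le_of_mem_occupied h) k), fun H => ?_⟩
  induction l using List.reverseRecOn with
  | nil => simp [parkOutcome]
  | append_singleton l p ih =>
    have h' : l.length ≤ t := by simp at h; omega
    have hl' : ∀ x ∈ l, 0 < x := fun x hx => hl x (by simp [hx])
    have hp : 0 < p := hl p (by simp)
    rw [parkOutcome_append_singleton h']
    intro o ho
    rw [List.mem_append, List.mem_singleton] at ho
    rcases ho with ho | rfl
    · refine ih h' hl' (fun k hk => ?_) o ho
      have := H k hk
      rw [List.countP_append] at this
      omega
    by_contra hn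
    rw [Option.not_isSome_iff_eq_none] at hn
    have h0 : 0 ∉ occupied n t l := fun h0 => (pos_of_mem_occupied h' hl' h0).false
    set P : ℕ → Prop := fun k => k ∉ occupied n t l with hP
    have hk0 : P (Nat.findGreatest P (p - 1)) := Nat.findGreatest_spec (Nat.zero_le _) h0
    set k := Nat.findGreatest P (p - 1) with hk
    have hkp : k ≤ p - 1 := Nat.findGreatest_le _
    have hall : ∀ x, k + 1 ≤ x → x ≤ n → x ∈ occupied n t l := by
      intro x hx hxn
      by_cases hxp : p ≤ x
      · exact nextSpot_eq_none hn hxp hxn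
      · by_contra hx'
        exact Nat.findGreatest_is_greatest (P := P) (n := p - 1) (k := x)
          (by omega) (by omega) hx'
    have h1 := le_countP_of_forall_mem hall
    have h2 := countP_occupied_le h' hk0
    have h3 := H (k + 1) (by omega)
    rw [List.countP_append, List.countP_singleton] at h3
    simp only [decide_eq_true_eq] at h3
    rw [if_pos (by omega)] at h3
    omega

lemma parkingFunction_iff (m n : ℕ) (l : List ℕ) :
    ParkingFunction m n l ↔ l.length = m ∧ (∀ x ∈ l, 0 < x) ∧
      ∀ k, 0 < k → l.countP (k ≤ ·) ≤ n + 1 - k := by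
  constructor
  · rintro ⟨h1, h2, h3⟩
    have h4 : ∀ x ∈ l, 0 < x := fun x hx => (mem_Icc.1 (h2 x hx)).1
    exact ⟨h1, h4, (forall_isSome_parkOutcome_iff h1.le h4).1 h3⟩
  · rintro ⟨h1, h2, h3⟩
    refine ⟨h1, fun x hx => mem_Icc.2 ⟨h2 x hx, ?_⟩, (forall_isSome_parkOutcome_iff h1.le h2).2 h3⟩
    by_contra hxn
    have h4 := h3 (n + 1) (by omega)
    have h5 : 0 < l.countP (n + 1 ≤ ·) :=
      List.countP_pos_iff.2 ⟨x, hx, by simpa using Nat.lt_of_not_le hxn⟩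
    omega

/-- The number of entries of `f` that are at least `k`. -/
def geCount {ι : Type*} [Fintype ι] (f : ι → ℕ) (k : ℕ) : ℕ := #{i | k ≤ f i}

/-- The parking functions with cars indexed by `ι` on the street with spots
`a + 1, …, a + n`. -/
def parkingFinset (ι : Type*) [Fintype ι] [DecidableEq ι] (a n : ℕ) : Finset (ι → ℕ) :=
  {f ∈ Fintype.piFinset fun _ => Ioc a (a + n) |
    ∀ k ∈ Ioc a (a + n), geCount f k ≤ a + n + 1 - k}

/-- Functions whose restrictions to `S` and to its complement are prescribed independently. -/
lemma card_eq_mul_of_mem_iff {ι : Type*} [DecidableEq ι] (S : Finset ι) {s : Finset (ι → ℕ)}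
    {A : Finset ({i // i ∈ S} → ℕ)} {B : Finset ({i // i ∉ S} → ℕ)}
    (h : ∀ f : ι → ℕ, f ∈ s ↔ (fun i : {i // i ∈ S} => f i) ∈ A ∧
      (fun i : {i // i ∉ S} => f i) ∈ B) : #s = #A * #B := by
  rw [← card_product]
  refine card_equiv (Equiv.piEquivPiSubtypeProd (· ∈ S) fun _ => ℕ) fun f => ?_
  rw [h, mem_product]
  rfl

section

variable {ι : Type*} [Fintype ι]

lemma geCount_eq_zero_iff {f : ι → ℕ} {k : ℕ} : geCount f k = 0 ↔ ∀ i, f i < k := by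
  simp [geCount, filter_eq_empty_iff]

lemma geCount_le_card (f : ι → ℕ) (k : ℕ) : geCount f k ≤ Fintype.card ι := card_le_univ _

lemma geCount_eq_card {f : ι → ℕ} {k : ℕ} (h : ∀ i, k ≤ f i) :
    geCount f k = Fintype.card ι := by
  rw [geCount, filter_true_of_mem fun i _ => h i, card_univ]

variable [DecidableEq ι]

lemma geCount_split (f : ι → ℕ) (S : Finset ι) (k : ℕ) :
    geCount f k = geCount (fun i : {i // i ∈ S} => f i) k +
      geCount (fun i : {i // i ∉ S} => f i) k := by
  simp only [geCount, card_filter]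
  convert (Fintype.sum_subtype_add_sum_subtype (· ∈ S) fun i => if k ≤ f i then 1 else 0).symm

lemma mem_parkingFinset {a n : ℕ} {f : ι → ℕ} :
    f ∈ parkingFinset ι a n ↔
      (∀ i, a < f i) ∧ ∀ k, a < k → geCount f k ≤ a + n + 1 - k := by
  simp only [parkingFinset, mem_filter, Fintype.mem_piFinset, mem_Ioc]
  constructor
  · rintro ⟨h1, h2⟩
    refine ⟨fun i => (h1 i).1, fun k hk => ?_⟩
    by_cases hkn : k ≤ a + n
    · exact h2 k ⟨hk, hkn⟩
    · rw [geCount_eq_zero_iff.2 fun i => by have := (h1 i).2; omega]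
      exact Nat.zero_le _
  · rintro ⟨h1, h2⟩
    refine ⟨fun i => ⟨h1 i, ?_⟩, fun k hk => h2 k hk.1⟩
    have h3 := h2 (a + n + 1) (by omega)
    have := geCount_eq_zero_iff.1 (Nat.le_zero.1 (by simpa using h3)) i
    omega

lemma parkingFinset_eq_empty {a n : ℕ} (h : n < Fintype.card ι) : parkingFinset ι a n = ∅ := by
  refine eq_empty_of_forall_notMem fun f hf => ?_
  rw [mem_parkingFinset] at hf
  have := hf.2 (a + 1) (by omega)
  rw [geCount_eq_card fun i => hf.1 i] at this
  omega

/-- Splitting off the cars that prefer the first spot. -/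
lemma card_parkingFinset_succ {a n : ℕ} (h : Fintype.card ι ≤ n + 1) :
    #(parkingFinset ι a (n + 1)) =
      ∑ S : Finset ι, #(parkingFinset {i // i ∈ S} (a + 1) n) := by
  rw [card_eq_sum_card_fiberwise (f := fun f => ({i | a + 1 < f i} : Finset ι)) (t := univ)
    (by simp)]
  refine sum_congr rfl fun S _ => ?_
  rw [card_eq_mul_of_mem_iff S (A := parkingFinset {i // i ∈ S} (a + 1) n)
    (B := {fun _ => a + 1}), card_singleton, mul_one]
  intro f
  rw [mem_filter, mem_parkingFinset, mem_parkingFinset, mem_singleton]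
  constructor
  · rintro ⟨⟨h1, h2⟩, h3⟩
    have h4 : ∀ i, i ∈ S ↔ a + 1 < f i := fun i => by simp [← h3]
    have h5 : ∀ i : {i // i ∉ S}, f i = a + 1 := fun i => by
      have := (h4 i).not.1 i.2
      have := h1 i
      omega
    refine ⟨⟨fun i => (h4 i).1 i.2, fun k hk => ?_⟩, funext h5⟩
    have := h2 k (by omega)
    rw [geCount_split f S] at this
    omega
  · rintro ⟨⟨h1, h2⟩, h3⟩
    have h3 : ∀ i (hi : i ∉ S), f i = a + 1 := fun i hi => congrFun h3 ⟨i, hi⟩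
    refine ⟨⟨fun i => ?_, fun k hk => ?_⟩, ?_⟩
    · by_cases hi : i ∈ S
      · have := h1 ⟨i, hi⟩
        dsimp only at this
        omega
      · rw [h3 i hi]; omega
    · rcases Nat.eq_or_lt_of_le (show a + 1 ≤ k from hk) with rfl | hk'
      · have := geCount_le_card f (a + 1)
        omega
      · have h4 := h2 k hk'
        rw [geCount_split f S,
          geCount_eq_zero_iff (f := fun i : {i // i ∉ S} => f i).2
            fun i => (h3 i i.2).trans_lt hk']
        omega
    · ext i
      simp only [mem_filter, mem_univ, true_and]
      by_cases hi : i ∈ S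
      · simpa [hi] using h1 ⟨i, hi⟩
      · simp [hi, h3 i hi]

end

lemma sum_choose_mul_sub_mul_pow (m : ℕ) (x : ℤ) :
    (x + 1) * ∑ r ∈ range (m + 1), (m.choose r : ℤ) * ((x - r) * x ^ r) =
      x * ((x + 1 - m) * (x + 1) ^ m) := by
  have h1 : ∑ r ∈ range (m + 1), (m.choose r : ℤ) * x ^ r = (x + 1) ^ m := by
    rw [add_pow]
    exact sum_congr rfl fun r _ => by ring
  have h2 : (x + 1) * ∑ r ∈ range (m + 1), (m.choose r : ℤ) * (r * x ^ r) =
      m * x * (x + 1) ^ m := by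
    cases m with
    | zero => simp
    | succ m =>
      rw [sum_range_succ', pow_succ, add_pow x 1 m]
      have : ∀ r ∈ range (m + 1), ((m + 1).choose (r + 1) : ℤ) * ((r + 1 : ℕ) * x ^ (r + 1)) =
          (m + 1) * x * (x ^ r * 1 ^ (m - r) * m.choose r) := fun r _ => by
        have := Nat.add_one_mul_choose_eq m r
        zify at this
        push_cast
        rw [one_pow]
        linear_combination (-x ^ (r + 1)) * this
      rw [sum_congr rfl this, ← mul_sum]
      push_cast
      ring
  have h3 : ∑ r ∈ range (m + 1), (m.choose r : ℤ) * ((x - r) * x ^ r) =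
      x * ∑ r ∈ range (m + 1), (m.choose r : ℤ) * x ^ r -
        ∑ r ∈ range (m + 1), (m.choose r : ℤ) * (r * x ^ r) := by
    rw [mul_sum, ← sum_sub_distrib]
    exact sum_congr rfl fun r _ => by ring
  rw [h3, mul_sub, h2, h1]
  ring

lemma card_parkingFinset_mul (n : ℕ) : ∀ (ι : Type*) [Fintype ι] [DecidableEq ι] (a : ℕ),
    Fintype.card ι ≤ n + 1 →
      ((n : ℤ) + 1) * #(parkingFinset ι a n) =
        (n + 1 - Fintype.card ι) * (n + 1) ^ Fintype.card ι := by
  induction n with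
  | zero =>
    intro ι _ _ a h
    rcases Nat.eq_zero_or_pos (Fintype.card ι) with h0 | h0
    · have := Fintype.card_eq_zero_iff.1 h0
      have h1 : parkingFinset ι a 0 = univ := by
        ext f
        simpa [mem_parkingFinset, geCount] using Subsingleton.elim _ _
      simp [h1]
    · have h1 : Fintype.card ι = 1 := by omega
      rw [parkingFinset_eq_empty h0, h1]
      simp
  | succ n ih =>
    intro ι _ _ a h
    rcases Nat.eq_or_lt_of_le h with h0 | h0
    · rw [parkingFinset_eq_empty (by omega), h0]
      push_cast
      simp
    · rw [card_parkingFinset_succ (by omega)]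
      have h1 : ((n : ℤ) + 1) * ∑ S : Finset ι, (#(parkingFinset {i // i ∈ S} (a + 1) n) : ℤ) =
          ∑ r ∈ range (Fintype.card ι + 1),
            ((Fintype.card ι).choose r : ℤ) * (((n + 1 : ℤ) - r) * (n + 1) ^ r) := by
        rw [mul_sum, ← card_univ, ← powerset_univ]
        have := sum_powerset_apply_card (fun r : ℕ => ((n + 1 : ℤ) - r) * (n + 1) ^ r)
          (x := (univ : Finset ι))
        simp only [nsmul_eq_mul] at this
        rw [← this]
        refine sum_congr rfl fun S _ => ?_
        have hS : Fintype.card {i // i ∈ S} = #S := Fintype.card_coe S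
        rw [ih {i // i ∈ S} (a + 1) (by rw [hS]; exact (card_le_univ S).trans (by omega)), hS]
      have h2 := sum_choose_mul_sub_mul_pow (Fintype.card ι) (n + 1)
      rw [← h1] at h2
      have h3 : ((n : ℤ) + 1) ≠ 0 := by positivity
      apply mul_left_cancel₀ h3
      push_cast
      linear_combination h2

lemma card_parkingFinset (ι : Type*) [Fintype ι] [DecidableEq ι] (a n : ℕ)
    (h : Fintype.card ι ≤ n) (h0 : 0 < Fintype.card ι) :
    #(parkingFinset ι a n) = (n + 1 - Fintype.card ι) * (n + 1) ^ (Fintype.card ι - 1) := by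
  have h1 := card_parkingFinset_mul n ι a (by omega)
  obtain ⟨c, hc⟩ : ∃ c, Fintype.card ι = c + 1 := ⟨_, (Nat.succ_pred_eq_of_pos h0).symm⟩
  have h3 : ((n : ℤ) + 1) ≠ 0 := by positivity
  zify [show Fintype.card ι ≤ n + 1 by omega]
  apply mul_left_cancel₀ h3
  rw [h1, hc, Nat.add_sub_cancel]
  ring

lemma card_parkingFinset_of_card_eq_zero (ι : Type*) [Fintype ι] [DecidableEq ι] (a n : ℕ)
    (h : Fintype.card ι = 0) : #(parkingFinset ι a n) = 1 := by
  have h1 := card_parkingFinset_mul n ι a (by omega)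
  rw [h] at h1
  have h3 : ((n : ℤ) + 1) ≠ 0 := by positivity
  zify
  apply mul_left_cancel₀ h3
  rw [h1]
  simp

/-- The parking functions with as many cars as spots. -/
lemma card_parkingFinset_self (ι : Type*) [Fintype ι] [DecidableEq ι] (a n : ℕ)
    (h : Fintype.card ι = n) : #(parkingFinset ι a n) = (n + 1) ^ (n - 1) := by
  rcases Nat.eq_zero_or_pos n with rfl | h0
  · rw [card_parkingFinset_of_card_eq_zero ι a 0 h]; simp
  · rw [card_parkingFinset ι a n h.le (by omega), h]; simp

/-- The preferences of the cars other than the first one, in a parking function whose first car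
prefers the spot `j`. -/
def tailFinset (ι : Type*) [Fintype ι] [DecidableEq ι] (n j : ℕ) : Finset (ι → ℕ) :=
  {g ∈ parkingFinset ι 0 n | ∀ k ∈ Ioc (0 : ℕ) j, geCount g k < n + 1 - k}

section

variable {ι : Type*} [Fintype ι] [DecidableEq ι]

lemma mem_tailFinset {n j : ℕ} {g : ι → ℕ} :
    g ∈ tailFinset ι n j ↔ (∀ i, 0 < g i) ∧ ∀ k, 0 < k →
      geCount g k + (if k ≤ j then 1 else 0) ≤ n + 1 - k := by
  simp only [tailFinset, mem_filter, mem_parkingFinset, mem_Ioc, zero_add]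
  constructor
  · rintro ⟨⟨h1, h2⟩, h3⟩
    refine ⟨h1, fun k hk => ?_⟩
    split_ifs with hkj
    · exact h3 k ⟨hk, hkj⟩
    · exact h2 k hk
  · rintro ⟨h1, h2⟩
    refine ⟨⟨h1, fun k hk => le_of_add_le_left (h2 k hk)⟩, fun k hk => ?_⟩
    have := h2 k hk.1
    rwa [if_pos hk.2] at this

lemma tailFinset_eq_empty (n : ℕ) : tailFinset ι n (n + 1) = ∅ := by
  refine eq_empty_of_forall_notMem fun g hg => ?_
  have := (mem_tailFinset.1 hg).2 (n + 1) (by omega)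
  simp at this

lemma tailFinset_succ_subset (n j : ℕ) : tailFinset ι n (j + 1) ⊆ tailFinset ι n j := by
  intro g hg
  rw [mem_tailFinset] at hg ⊢
  refine ⟨hg.1, fun k hk => ?_⟩
  have := hg.2 k hk
  split_ifs at this ⊢ <;> omega

lemma mem_tailFinset_sdiff {n j : ℕ} (hjn : j ≤ n) {g : ι → ℕ} :
    g ∈ tailFinset ι n j \ tailFinset ι n (j + 1) ↔
      g ∈ tailFinset ι n j ∧ geCount g (j + 1) = n - j := by
  rw [mem_sdiff]
  refine and_congr_right fun hg => ?_
  rw [mem_tailFinset] at hg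
  have h1 := hg.2 (j + 1) (by omega)
  rw [if_neg (by omega)] at h1
  constructor
  · intro h
    by_contra hne
    refine h (mem_tailFinset.2 ⟨hg.1, fun k hk => ?_⟩)
    have h2 := hg.2 k hk
    rcases Nat.lt_trichotomy k (j + 1) with hlt | rfl | hlt
    · rw [if_pos (by omega)] at h2 ⊢; omega
    · rw [if_pos le_rfl]; omega
    · rw [if_neg (by omega)] at h2 ⊢; omega
  · intro h h'
    have := (mem_tailFinset.1 h').2 (j + 1) (by omega)
    rw [if_pos le_rfl] at this
    omega

/-- The cars that prefer a spot beyond `j` fill all of these spots. -/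
lemma card_fiber_tailFinset {n j : ℕ} (hj : 0 < j) (hjn : j ≤ n) (S : Finset ι)
    (hS : #S = n - j) :
    #{g ∈ tailFinset ι n j \ tailFinset ι n (j + 1) | ({i | j < g i} : Finset ι) = S} =
      #(parkingFinset {i // i ∈ S} j (n - j)) * #(parkingFinset {i // i ∉ S} 0 (j - 1)) := by
  refine card_eq_mul_of_mem_iff S fun g => ?_
  rw [mem_filter, mem_tailFinset_sdiff hjn, mem_tailFinset, mem_parkingFinset, mem_parkingFinset]
  constructor
  · rintro ⟨⟨⟨h1, h2⟩, -⟩, h3⟩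
    have h4 : ∀ i, i ∈ S ↔ j < g i := fun i => by simp [← h3]
    refine ⟨⟨fun i => (h4 i).1 i.2, fun k hk => ?_⟩, fun i => h1 i, fun k hk => ?_⟩
    · have := h2 k (by omega)
      rw [geCount_split g S] at this
      omega
    · by_cases hkj : k ≤ j
      · have h5 := h2 k hk
        rw [if_pos hkj, geCount_split g S, geCount_eq_card (f := fun i : {i // i ∈ S} => g i)
          fun i => hkj.trans ((h4 i).1 i.2).le, Fintype.card_coe, hS] at h5
        omega
      · rw [geCount_eq_zero_iff.2 fun i => ?_]
        · exact Nat.zero_le _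
        · have := (h4 i).not.1 i.2
          omega
  · rintro ⟨⟨h1, h2⟩, h3, h4⟩
    have h5 : ∀ i : {i // i ∉ S}, g i < j := by
      refine geCount_eq_zero_iff.1 ?_
      have := h4 j hj
      omega
    have h6 : ∀ k, j ≤ k → geCount (fun i : {i // i ∉ S} => g i) k = 0 := fun k hk =>
      geCount_eq_zero_iff.2 fun i => (h5 i).trans_le hk
    have h7 : ∀ k, k ≤ j + 1 → geCount (fun i : {i // i ∈ S} => g i) k = n - j := fun k hk => by
      rw [geCount_eq_card fun i => hk.trans (h1 i), Fintype.card_coe, hS]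
    refine ⟨⟨⟨fun i => ?_, fun k hk => ?_⟩, ?_⟩, ?_⟩
    · by_cases hi : i ∈ S
      · exact hj.trans (h1 ⟨i, hi⟩)
      · exact h3 ⟨i, hi⟩
    · rw [geCount_split g S]
      split_ifs with hkj
      · rw [h7 k (by omega)]
        have := h4 k hk
        omega
      · rw [h6 k (by omega)]
        have := h2 k (by omega)
        omega
    · rw [geCount_split g S, h6 _ (by omega), h7 _ le_rfl, add_zero]
    · ext i
      simp only [mem_filter, mem_univ, true_and]
      by_cases hi : i ∈ S
      · simpa [hi] using h1 ⟨i, hi⟩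
      · have := h5 ⟨i, hi⟩
        simp only [hi, iff_false, not_lt]
        exact this.le

lemma card_tailFinset_eq_add {n j c : ℕ} (hj : 0 < j) (hjn : j ≤ n)
    (hc : ∀ S : Finset ι, #S = n - j → #(parkingFinset {i // i ∉ S} 0 (j - 1)) = c) :
    #(tailFinset ι n j) = #(tailFinset ι n (j + 1)) +
      (Fintype.card ι).choose (n - j) * ((n - j + 1) ^ (n - j - 1) * c) := by
  rw [← card_sdiff_add_card_eq_card (tailFinset_succ_subset n j), add_comm]
  congr 1
  rw [card_eq_sum_card_fiberwise (f := fun g => ({i | j < g i} : Finset ι))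
    (t := powersetCard (n - j) univ)]
  · rw [sum_congr rfl (g := fun _ => (n - j + 1) ^ (n - j - 1) * c), sum_const,
      card_powersetCard, card_univ, smul_eq_mul]
    intro S hS
    have hS := (mem_powersetCard.1 hS).2
    rw [card_fiber_tailFinset hj hjn S hS, hc S hS,
      card_parkingFinset_self _ _ _ ((Fintype.card_coe S).trans hS)]
  · intro g hg
    have := ((mem_tailFinset_sdiff hjn).1 hg).2
    exact mem_powersetCard.2 ⟨subset_univ _, this⟩

lemma card_notMem (S : Finset ι) : Fintype.card {i // i ∉ S} = Fintype.card ι - #S := by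
  rw [Fintype.card_subtype_compl, Fintype.card_coe]

variable {m n : ℕ}

lemma card_tailFinset_of_lt (hm : Fintype.card ι = m - 1) (h2 : m ≤ n) {j : ℕ}
    (hj : n - m + 1 < j) (hjn : j ≤ n + 1) :
    #(tailFinset ι n j) = ∑ i ∈ Icc j n,
      Nat.choose (m - 1) (n - i) * (n - m + 1) * i ^ (i + m - n - 2) *
        (n - i + 1) ^ (n - i - 1) := by
  induction hjn using Nat.decreasingInduction with
  | self => rw [tailFinset_eq_empty]; simp
  | of_succ j hjn ih =>
    have hjn' : j ≤ n := by omega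
    rw [← add_sum_Ioc_eq_sum_Icc hjn', ← Icc_add_one_left_eq_Ioc, ← ih (by omega),
      card_tailFinset_eq_add (c := (n - m + 1) * j ^ (j + m - n - 2)) (by omega) hjn', hm]
    · ring
    · intro S hS
      have hc := card_notMem S
      rw [hS, hm] at hc
      rw [card_parkingFinset _ _ _ (by omega) (by omega), hc]
      congr 1
      · omega
      · congr 1 <;> omega

lemma card_tailFinset_of_le (hm : Fintype.card ι = m - 1) (h1 : 1 ≤ m) (h2 : m ≤ n) {j : ℕ}
    (hj0 : 0 < j) (hj : j ≤ n - m + 1) :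
    #(tailFinset ι n j) = m ^ (m - 2) + ∑ i ∈ Icc (n - m + 2) n,
      Nat.choose (m - 1) (n - i) * (n - m + 1) * i ^ (i + m - n - 2) *
        (n - i + 1) ^ (n - i - 1) := by
  induction hj using Nat.decreasingInduction with
  | self =>
    rw [← card_tailFinset_of_lt hm h2 (by omega) (by omega),
      card_tailFinset_eq_add (c := 1) (by omega) (by omega), add_comm]
    · rw [hm, show n - (n - m + 1) = m - 1 by omega, Nat.choose_self, mul_one, one_mul]
      congr 2
      omega
    · intro S hS
      refine card_parkingFinset_of_card_eq_zero _ _ _ ?_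
      rw [card_notMem, hm]
      omega
  | of_succ j hj ih =>
    rw [← ih (by omega), card_tailFinset_eq_add (c := 0) hj0 (by omega), hm,
      Nat.choose_eq_zero_of_lt (by omega), zero_mul, add_zero]
    intro S hS
    have := card_le_univ S
    omega

end

lemma countP_ofFn_eq_geCount {r : ℕ} (g : Fin r → ℕ) (k : ℕ) :
    (List.ofFn g).countP (k ≤ ·) = geCount g k := by
  rw [geCount, List.ofFn_eq_map, List.countP_map, List.countP_eq_length_filter,
    ← List.toFinset_card_of_nodup ((List.nodup_finRange r).filter _)]
  congr 1
  ext i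
  simp

lemma ncard_parkingFunction_headI {m n j : ℕ} (h1 : 1 ≤ m) (hj : 0 < j) :
    Set.ncard {l : List ℕ | ParkingFunction m n l ∧ l.headI = j} =
      #(tailFinset (Fin (m - 1)) n j) := by
  have hinj : Function.Injective fun g : Fin (m - 1) → ℕ => j :: List.ofFn g :=
    fun g g' h => List.ofFn_injective (List.cons.inj h).2
  rw [← Set.ncard_coe_finset, ← Set.ncard_image_of_injective _ hinj]
  congr 1
  have key : ∀ g : Fin (m - 1) → ℕ,
      ParkingFunction m n (j :: List.ofFn g) ↔ g ∈ tailFinset (Fin (m - 1)) n j := fun g => by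
    rw [parkingFunction_iff, mem_tailFinset]
    simp only [List.length_cons, List.length_ofFn, List.forall_mem_cons, List.forall_mem_ofFn_iff,
      List.countP_cons, countP_ofFn_eq_geCount, decide_eq_true_eq, hj, true_and]
    exact and_iff_right (by omega)
  ext l
  simp only [Set.mem_ofPred_eq, Set.mem_image, mem_coe]
  constructor
  · rintro ⟨hl, rfl⟩
    obtain ⟨x, l, rfl⟩ := List.exists_cons_of_length_pos (l := l) (by rw [hl.1]; omega)
    obtain rfl : m = l.length + 1 := by simpa using hl.1.symm
    refine ⟨l.get, (key _).1 ?_, ?_⟩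
    · simpa using hl
    · simp
  · rintro ⟨g, hg, rfl⟩
    exact ⟨(key g).2 hg, rfl⟩

end ParkingCount

/-- Let `1 ≤ m ≤ n` and `j ∈ [n]`.  If `j > n-m+1`, the number of
`(m,n)`-parking functions with first entry `j` is
`Σ_{i=j}^{n} C(m-1, n-i)·(n-m+1)·i^{i+m-n-2}·(n-i+1)^{n-i-1}`; if `j ≤ n-m+1`, it is
`m^{m-2} + Σ_{i=n-m+2}^{n} C(m-1, n-i)·(n-m+1)·i^{i+m-n-2}·(n-i+1)^{n-i-1}`.
(`1^{-1}` is interpreted as `1`, which is what ℕ-truncation gives here.) -/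
theorem parking_function_first_entry_count (m n j : ℕ) (h1 : 1 ≤ m) (h2 : m ≤ n)
    (hj : j ∈ Finset.Icc 1 n) :
    (n - m + 1 < j →
      Set.ncard {l : List ℕ | ParkingFunction m n l ∧ l.headI = j} =
        ∑ i ∈ Finset.Icc j n,
          Nat.choose (m - 1) (n - i) * (n - m + 1) * i ^ (i + m - n - 2) *
            (n - i + 1) ^ (n - i - 1)) ∧
    (j ≤ n - m + 1 →
      Set.ncard {l : List ℕ | ParkingFunction m n l ∧ l.headI = j} =
        m ^ (m - 2) + ∑ i ∈ Finset.Icc (n - m + 2) n,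
          Nat.choose (m - 1) (n - i) * (n - m + 1) * i ^ (i + m - n - 2) *
            (n - i + 1) ^ (n - i - 1)) := by
  obtain ⟨hj0, hjn⟩ := Finset.mem_Icc.1 hj
  rw [ParkingCount.ncard_parkingFunction_headI h1 hj0]
  have hm : Fintype.card (Fin (m - 1)) = m - 1 := Fintype.card_fin _
  exact ⟨fun h => ParkingCount.card_tailFinset_of_lt hm h2 h (by omega),
    fun h => ParkingCount.card_tailFinset_of_le hm h1 h2 hj0 h⟩
end
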